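/- Let X be a geometrically integral curve over a perfect field k and let d be a positive integer. If F is a d-controlled subfield of k(X) and f ∈ k(X) is a rational function of degree d (that is, [k(X) : k(f)] = d), then the compositum F(f) inside k(X) is also d-controlled. -/

import Mathlib

open IntermediateField

/-- The gonality of the function field `F` of a curve over `k`: the smallest degree
`[F : k(f)]` of a nonconstant rational function `f ∈ F`, i.e. the smallest degree of a
dominant rational map from the curve to `ℙ¹_k`. -/
noncomputable def gonality (k F : Type*) [Field k] [Field F] [Algebra k F] : ℕ :=
  sInf {d : ℕ | ∃ f : F, Transcendental k f ∧
    Module.finrank (IntermediateField.adjoin k {f}) F = d}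

/-- `F` is the function field of a curve over `k`: a finitely generated field extension of
transcendence degree 1, i.e. a finite extension of some `k(x)` with `x` transcendental. -/
def IsFunctionField (k F : Type*) [Field k] [Field F] [Algebra k F] : Prop :=
  ∃ x : F, Transcendental k x ∧
    FiniteDimensional (IntermediateField.adjoin k {x}) F

/-- A place of the function field `F/k`: a valuation subring of `F` containing `k`
and different from `F` itself.  These correspond to the closed points of the smooth
projective model of the curve. -/
structure FFPlace (k F : Type*) [Field k] [Field F] [Algebra k F] where
  asSubring : ValuationSubring F
  algebraMap_mem : ∀ a : k, algebraMap k F a ∈ asSubring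
  ne_top : asSubring ≠ ⊤

variable (k F : Type*) [Field k] [Field F] [Algebra k F]

/-- The degree of a place: the `k`-dimension of its residue field. -/
noncomputable def FFPlace.degree (P : FFPlace k F) : ℕ :=
  letI : Algebra k (IsLocalRing.ResidueField P.asSubring) :=
    ((IsLocalRing.residue (P.asSubring : Type _)).comp
      ((algebraMap k F).codRestrict P.asSubring.toSubring P.algebraMap_mem)).toAlgebra
  Module.finrank k (IsLocalRing.ResidueField P.asSubring)

/-- The space of adeles (repartitions) of `F/k`: families `(α_P)_P` indexed by the places of
`F/k` with `α_P` integral at all but finitely many places, as a `k`-submodule of `Π_P F`. -/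
def adeleSubmodule : Submodule k (FFPlace k F → F) where
  carrier := {α | {P : FFPlace k F | α P ∉ P.asSubring}.Finite}
  zero_mem' := by
    show {P : FFPlace k F | (0 : F) ∉ P.asSubring}.Finite
    convert Set.finite_empty using 2
    ext P
    simp [zero_mem]
  add_mem' := by
    intro a b ha hb
    refine Set.Finite.subset (ha.union hb) ?_
    intro P hP
    rw [Set.mem_union]
    by_contra h
    push_neg at h
    simp only [Set.mem_setOf_eq, not_not] at h
    exact hP (add_mem h.1 h.2)
  smul_mem' := by
    intro c α hα
    refine Set.Finite.subset hα ?_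
    intro P hP
    by_contra h
    simp only [Set.mem_setOf_eq, not_not] at h
    refine hP ?_
    show c • α P ∈ P.asSubring
    rw [Algebra.smul_def]
    exact mul_mem (P.algebraMap_mem c) h

/-- The adeles that are integral at every place. -/
def integralAdeles : Submodule k (FFPlace k F → F) where
  carrier := {α | ∀ P : FFPlace k F, α P ∈ P.asSubring}
  zero_mem' := fun P => zero_mem _
  add_mem' := fun ha hb P => add_mem (ha P) (hb P)
  smul_mem' := by
    intro c α hα P
    show c • α P ∈ P.asSubring
    rw [Algebra.smul_def]
    exact mul_mem (P.algebraMap_mem c) (hα P)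

/-- The principal adeles: the diagonal image of `F`. -/
def principalAdeles : Submodule k (FFPlace k F → F) :=
  LinearMap.range (LinearMap.pi fun _ : FFPlace k F => (LinearMap.id : F →ₗ[k] F))

/-- The genus of the function field `F/k`, defined à la Chevalley/Weil as the `k`-dimension of
`A / (A(0) + F)`, where `A` is the space of adeles, `A(0)` the everywhere-integral ones and `F`
the principal ones.  For the function field of a geometrically integral smooth projective curve
this is the usual genus. -/
noncomputable def genus : ℕ :=
  Module.finrank k
    (↥(adeleSubmodule k F) ⧸
      ((integralAdeles k F ⊔ principalAdeles k F).comap (adeleSubmodule k F).subtype))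

/-- `E` is a `d`-controlled subfield of `F`: `[F : E] = d/e` for some positive integer `e`
dividing `d`, and the genus of `E` is at most `(e-1)²`. -/
def IsDControlled (d : ℕ) (E : IntermediateField k F) : Prop :=
  ∃ e : ℕ, 0 < e ∧ e * Module.finrank E F = d ∧ genus k E ≤ (e - 1) ^ 2

section Places

/-- Every simple extension of `k` generated by a transcendental element has finite index in `K`. -/
def FiniteOverTranscendental (k K : Type*) [Field k] [Field K] [Algebra k K] : Prop :=
  ∀ y : K, Transcendental k y → FiniteDimensional k⟮y⟯ K

variable {k K : Type*} [Field k] [Field K] [Algebra k K]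

namespace FFPlace

/-- The valuation attached to a place. -/
noncomputable abbrev val (P : FFPlace k K) : Valuation K P.asSubring.ValueGroup :=
  P.asSubring.valuation

lemma mem_iff (P : FFPlace k K) (x : K) : x ∈ P.asSubring ↔ P.val x ≤ 1 :=
  (P.asSubring.valuation_le_one_iff x).symm

lemma ext_asSubring {P Q : FFPlace k K} (h : P.asSubring = Q.asSubring) : P = Q := by
  cases P; cases Q; cases h; rfl

lemma val_algebraMap_le_one (P : FFPlace k K) (a : k) : P.val (algebraMap k K a) ≤ 1 :=
  (P.mem_iff _).1 (P.algebraMap_mem a)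

lemma val_algebraMap (P : FFPlace k K) {a : k} (ha : a ≠ 0) : P.val (algebraMap k K a) = 1 := by
  refine le_antisymm (P.val_algebraMap_le_one a) ?_
  have h := P.val_algebraMap_le_one a⁻¹
  rw [map_inv₀, map_inv₀] at h
  exact (inv_le_one₀ (zero_lt_iff.2 ((Valuation.ne_zero_iff _).2 (by simpa using ha)))).1 h

lemma mem_of_isIntegral_of_le (P : FFPlace k K) {R : Subalgebra k K}
    (hR : ∀ r ∈ R, r ∈ P.asSubring) {x : K} (hx : IsIntegral R x) : x ∈ P.asSubring := by
  let φ : R →+* P.asSubring :=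
    { toFun := fun r => ⟨r, hR r r.2⟩
      map_one' := rfl
      map_mul' := fun _ _ => rfl
      map_zero' := rfl
      map_add' := fun _ _ => rfl }
  have h : IsIntegral P.asSubring x := hx.map_of_comp_eq φ (RingHom.id K) (by ext; rfl)
  obtain ⟨y, rfl⟩ := IsIntegrallyClosed.isIntegral_iff.1 h
  exact y.2

lemma mem_of_isAlgebraic (P : FFPlace k K) {x : K} (hx : IsAlgebraic k x) : x ∈ P.asSubring := by
  refine P.mem_of_isIntegral_of_le (R := ⊥) ?_ (hx.isIntegral.tower_top)
  rintro r hr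
  obtain ⟨a, rfl⟩ := Algebra.mem_bot.1 hr
  exact P.algebraMap_mem a

lemma transcendental_of_val_lt_one (P : FFPlace k K) {y : K} (hy0 : y ≠ 0) (hy : P.val y < 1) :
    Transcendental k y := by
  intro h
  have h1 := (P.mem_iff _).1 (P.mem_of_isAlgebraic h.inv)
  rw [map_inv₀, inv_le_one₀ (zero_lt_iff.2 ((Valuation.ne_zero_iff _).2 hy0))] at h1
  exact absurd h1 hy.not_ge

lemma exists_val_lt_one (P : FFPlace k K) : ∃ y : K, y ≠ 0 ∧ P.val y < 1 := by
  by_contra! h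
  refine P.ne_top (eq_top_iff.2 fun x _ => ?_)
  rw [P.mem_iff]
  rcases eq_or_ne x 0 with rfl | hx
  · simp
  have h1 := h x⁻¹ (inv_ne_zero hx)
  rw [map_inv₀, one_le_inv₀ (zero_lt_iff.2 ((Valuation.ne_zero_iff _).2 hx))] at h1
  exact h1

lemma val_aeval_le_one (P : FFPlace k K) {y : K} (hy : P.val y ≤ 1) (p : Polynomial k) :
    P.val (Polynomial.aeval y p) ≤ 1 := by
  rw [Polynomial.aeval_eq_sum_range]
  refine Valuation.map_sum_le _ fun i _ => ?_
  rw [Algebra.smul_def, map_mul, map_pow]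
  exact mul_le_one' (P.val_algebraMap_le_one _) (pow_le_one₀ zero_le hy)

lemma val_aeval_of_coeff_zero_ne_zero (P : FFPlace k K) {y : K} (hy : P.val y < 1)
    {p : Polynomial k} (hp : p.coeff 0 ≠ 0) : P.val (Polynomial.aeval y p) = 1 := by
  rw [← Polynomial.divX_mul_X_add p, map_add, map_mul, Polynomial.aeval_X, Polynomial.aeval_C,
    Valuation.map_add_eq_of_lt_right, P.val_algebraMap hp]
  rw [P.val_algebraMap hp, map_mul]
  exact mul_lt_one_of_nonneg_of_lt_one_right (P.val_aeval_le_one hy.le _) zero_le hy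

lemma exists_val_aeval_eq_pow (P : FFPlace k K) {y : K} (hy : P.val y < 1)
    {p : Polynomial k} (hp : p ≠ 0) : ∃ n : ℕ, P.val (Polynomial.aeval y p) = P.val y ^ n := by
  obtain ⟨q, hq, hq'⟩ := Polynomial.exists_eq_pow_rootMultiplicity_mul_and_not_dvd p hp 0
  refine ⟨p.rootMultiplicity 0, ?_⟩
  rw [map_zero, sub_zero, Polynomial.X_dvd_iff] at hq'
  conv_lhs => rw [hq]
  simp [P.val_aeval_of_coeff_zero_ne_zero hy hq']

lemma exists_pow_mul_lt_one (hK : FiniteOverTranscendental k K) (P : FFPlace k K) {y : K}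
    (hy0 : y ≠ 0) (hy : P.val y < 1) (x : K) :
    ∃ n : ℕ, ∀ m ≥ n, P.val y ^ m * P.val x < 1 := by
  have := hK y (P.transcendental_of_val_lt_one hy0 hy)
  have hx : IsAlgebraic (Algebra.adjoin k {y}) x := by
    open scoped IntermediateField.algebraAdjoinAdjoin in
    have h : IsAlgebraic k⟮y⟯ x := Algebra.IsAlgebraic.isAlgebraic x
    exact (IsFractionRing.isAlgebraic_iff (Algebra.adjoin k {y}) k⟮y⟯ K).2 h
  obtain ⟨⟨c, hc⟩, hc0, hint⟩ := hx.exists_integral_multiple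
  have h1 := P.mem_of_isIntegral_of_le (R := Algebra.adjoin k {y}) ?_ hint
  · obtain ⟨p, rfl⟩ := Algebra.adjoin_mem_exists_aeval k y hc
    have hp : p ≠ 0 := by
      rintro rfl
      exact hc0 (by ext; simp)
    obtain ⟨n, hn⟩ := P.exists_val_aeval_eq_pow hy hp
    rw [P.mem_iff, Subalgebra.smul_def, smul_eq_mul, map_mul, hn] at h1
    refine ⟨n + 1, fun m hm => ?_⟩
    obtain ⟨j, rfl⟩ := Nat.exists_eq_add_of_le hm
    calc P.val y ^ (n + 1 + j) * P.val x = (P.val y ^ n * P.val x) * P.val y ^ (j + 1) := by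
          rw [pow_add, pow_add, pow_add, pow_one]; simp only [mul_assoc, mul_comm, mul_left_comm]
      _ < 1 := mul_lt_one_of_nonneg_of_lt_one_right h1 zero_le
          (pow_lt_one₀ zero_le hy (by omega))
  · intro r hr
    obtain ⟨p, rfl⟩ := Algebra.adjoin_mem_exists_aeval k y hr
    exact (P.mem_iff _).2 (P.val_aeval_le_one hy.le p)

lemma exists_val_le_one_lt_val (hK : FiniteOverTranscendental k K) {P Q : FFPlace k K}
    (hPQ : P ≠ Q) : ∃ x : K, P.val x ≤ 1 ∧ 1 < Q.val x := by
  by_contra! h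
  have hz : ∃ z, Q.val z ≤ 1 ∧ 1 < P.val z := by
    by_contra! h'
    exact hPQ (ext_asSubring (ValuationSubring.ext _ _ fun x => by
      rw [P.mem_iff, Q.mem_iff]; exact ⟨h x, h' x⟩))
  obtain ⟨z, hz, hz'⟩ := hz
  have hz0 : z ≠ 0 := by rintro rfl; simp at hz'
  have hzi : P.val z⁻¹ < 1 := by rw [map_inv₀]; exact inv_lt_one_of_one_lt₀ hz'
  refine Q.ne_top (eq_top_iff.2 fun x _ => ?_)
  obtain ⟨n, hn⟩ := P.exists_pow_mul_lt_one hK (inv_ne_zero hz0) hzi x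
  have h1 := hn n le_rfl
  rw [← map_pow, ← map_mul] at h1
  have h2 := h _ h1.le
  rw [Q.mem_iff]
  have hx : x = z ^ n * (z⁻¹ ^ n * x) := by
    rw [← mul_assoc, ← mul_pow, mul_inv_cancel₀ hz0, one_pow, one_mul]
  rw [hx, map_mul, map_pow]
  exact mul_le_one' (pow_le_one₀ zero_le hz) h2

/-- Separation of finitely many places. -/
lemma exists_one_lt_val_forall_val_lt_one (hK : FiniteOverTranscendental k K) (P : FFPlace k K)
    (S : Finset (FFPlace k K)) (hP : P ∉ S) : ∃ u : K, 1 < P.val u ∧ ∀ Q ∈ S, Q.val u < 1 := by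
  classical
  induction S using Finset.induction_on with
  | empty =>
    obtain ⟨y, hy0, hy⟩ := P.exists_val_lt_one
    exact ⟨y⁻¹, by rw [map_inv₀]; exact (one_lt_inv₀ (zero_lt_iff.2
      ((Valuation.ne_zero_iff _).2 hy0))).2 hy, by simp⟩
  | insert Q S hQ ih =>
    rw [Finset.mem_insert, not_or] at hP
    obtain ⟨u, hu, huS⟩ := ih hP.2
    obtain ⟨z, hz, hzQ⟩ : ∃ z : K, 1 < P.val z ∧ Q.val z < 1 := by
      obtain ⟨a, ha, ha'⟩ := exists_val_le_one_lt_val hK hP.1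
      obtain ⟨b, hb, hb'⟩ := exists_val_le_one_lt_val hK (Ne.symm hP.1)
      refine ⟨b / a, ?_, ?_⟩
      · have ha0 : a ≠ 0 := by rintro rfl; simp at ha'
        rw [map_div₀, one_lt_div₀ (zero_lt_iff.2 ((Valuation.ne_zero_iff _).2 ha0))]
        exact ha.trans_lt hb'
      · rw [map_div₀, div_lt_one₀ (zero_lt_one.trans ha')]
        exact hb.trans_lt ha'
    have hu0 : u ≠ 0 := by rintro rfl; simp at hu
    have hS : ∃ n : ℕ, ∀ m ≥ n, ∀ R ∈ S, R.val u ^ m * R.val z < 1 := by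
      choose! N hN using fun (R : FFPlace k K) hR => R.exists_pow_mul_lt_one hK hu0 (huS R hR) z
      refine ⟨S.sup N, fun m hm R hR => hN R hR m ((Finset.le_sup hR).trans hm)⟩
    obtain ⟨n, hn⟩ := hS
    rcases le_or_gt (Q.val u) 1 with h | h
    · refine ⟨u ^ n * z, ?_, ?_⟩
      · rw [map_mul, map_pow]
        exact one_lt_mul_of_le_of_lt (one_le_pow₀ hu.le) hz
      · intro R hR
        rw [map_mul, map_pow]
        rcases Finset.mem_insert.1 hR with rfl | hR
        · exact mul_lt_one_of_nonneg_of_lt_one_right (pow_le_one₀ zero_le h) zero_le hzQ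
        · exact hn n le_rfl R hR
    · have key : ∀ R : FFPlace k K, 1 < R.val u → R.val (1 + u ^ (n + 1)) = R.val (u ^ (n + 1)) :=
        fun R hR => Valuation.map_add_eq_of_lt_right _ (by
          rw [map_one, map_pow]; exact one_lt_pow₀ hR (by omega))
      have key' : ∀ R : FFPlace k K, 1 < R.val u → R.val (u ^ (n + 1) * z / (1 + u ^ (n + 1)))
          = R.val z := fun R hR => by
        rw [map_div₀, key R hR, map_mul, mul_div_assoc, mul_div_cancel₀]
        rw [map_pow]; exact pow_ne_zero _ (zero_lt_one.trans hR).ne'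
      refine ⟨u ^ (n + 1) * z / (1 + u ^ (n + 1)), (key' P hu).symm ▸ hz, ?_⟩
      intro R hR
      rcases Finset.mem_insert.1 hR with rfl | hR
      · exact (key' _ h).symm ▸ hzQ
      · rw [map_div₀, Valuation.map_one_add_of_lt, div_one, map_mul, map_pow]
        · exact hn (n + 1) (by omega) R hR
        · rw [map_pow]; exact pow_lt_one₀ zero_le (huS R hR) (by omega)

lemma exists_val_sub_le_one_forall_val_le_one (hK : FiniteOverTranscendental k K)
    (P : FFPlace k K) (S : Finset (FFPlace k K)) (hP : P ∉ S) (a : K) :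
    ∃ x : K, P.val (x - a) ≤ 1 ∧ ∀ Q ∈ S, Q.val x ≤ 1 := by
  obtain ⟨u, hu, huS⟩ := exists_one_lt_val_forall_val_lt_one hK P S hP
  have hu0 : u ≠ 0 := by rintro rfl; simp at hu
  have hui : P.val u⁻¹ < 1 := by rw [map_inv₀]; exact inv_lt_one_of_one_lt₀ hu
  obtain ⟨n, hn⟩ := P.exists_pow_mul_lt_one hK (inv_ne_zero hu0) hui a
  choose! N hN using fun (R : FFPlace k K) hR => R.exists_pow_mul_lt_one hK hu0 (huS R hR) a
  set m := n + S.sup N + 1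
  have hPm : P.val (1 + u ^ m) = P.val u ^ m := by
    rw [Valuation.map_add_eq_of_lt_right, map_pow]
    rw [map_one, map_pow]; exact one_lt_pow₀ hu (by omega)
  have h0 : 1 + u ^ m ≠ 0 := by
    rw [← Valuation.ne_zero_iff P.val, hPm]
    exact pow_ne_zero _ (zero_lt_one.trans hu).ne'
  refine ⟨a * u ^ m / (1 + u ^ m), ?_, fun Q hQ => ?_⟩
  · have : a * u ^ m / (1 + u ^ m) - a = - (a / (1 + u ^ m)) := by field_simp; ring
    rw [this, Valuation.map_neg, map_div₀, hPm, div_eq_inv_mul, ← inv_pow, ← map_inv₀]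
    exact (hn m (by omega)).le
  · rw [map_div₀, Valuation.map_one_add_of_lt, div_one, mul_comm, map_mul, map_pow]
    · refine (hN Q hQ m ?_).le
      have := Finset.le_sup (f := N) hQ
      omega
    · rw [map_pow]; exact pow_lt_one₀ zero_le (huS Q hQ) (by omega)

/-- Weak approximation modulo integral elements. -/
lemma exists_forall_val_sub_le_one (hK : FiniteOverTranscendental k K)
    (S : Finset (FFPlace k K)) (a : FFPlace k K → K) :
    ∃ x : K, ∀ P ∈ S, P.val (x - a P) ≤ 1 := by
  classical
  choose x hx hx' using fun P : FFPlace k K =>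
    exists_val_sub_le_one_forall_val_le_one hK P (S.erase P) (Finset.notMem_erase P S) (a P)
  refine ⟨∑ P ∈ S, x P, fun P hP => ?_⟩
  rw [← Finset.add_sum_erase S x hP, add_sub_right_comm]
  refine Valuation.map_add_le _ (hx P) (Valuation.map_sum_le _ fun Q hQ => ?_)
  exact hx' Q P (Finset.mem_erase.2 ⟨(Finset.ne_of_mem_erase hQ).symm, hP⟩)

end FFPlace

end Places

section Independence

variable {k K : Type*} [Field k] [Field K] [Algebra k K]

lemma linearIndependent_adjoin_simple_of_aeval {ι : Type*} [Fintype ι] {y : K} {v : ι → K}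
    (h : ∀ p : ι → Polynomial k, ∑ i, Polynomial.aeval y (p i) * v i = 0 → ∀ i, p i = 0) :
    LinearIndependent k⟮y⟯ v := by
  open scoped IntermediateField.algebraAdjoinAdjoin in
  rw [← LinearIndependent.iff_fractionRing (R := Algebra.adjoin k {y}),
    Fintype.linearIndependent_iff]
  intro g hg i
  choose p hp using fun i => Algebra.adjoin_mem_exists_aeval k y (g i).2
  have h0 := h p (by simpa [hp, Subalgebra.smul_def] using hg) i
  ext
  rw [← hp i, h0]; simp

lemma linearIndependent_adjoin_simple_of_coeff_zero {ι : Type*} [Fintype ι] {y : K} (hy : y ≠ 0)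
    {v : ι → K} (h : ∀ p : ι → Polynomial k, ∑ i, Polynomial.aeval y (p i) * v i = 0 →
      ∀ i, (p i).coeff 0 = 0) :
    LinearIndependent k⟮y⟯ v := by
  refine linearIndependent_adjoin_simple_of_aeval fun p hp => ?_
  have key : ∀ n : ℕ, ∀ i, Polynomial.X ^ n ∣ p i := by
    intro n
    induction n with
    | zero => simp
    | succ n ih =>
      choose q hq using ih
      have hq0 : ∑ i, Polynomial.aeval y (q i) * v i = 0 := by
        have h1 : y ^ n * ∑ i, Polynomial.aeval y (q i) * v i = 0 := by
          rw [← hp, Finset.mul_sum]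
          refine Finset.sum_congr rfl fun i _ => ?_
          rw [hq i]; simp [mul_assoc]
        exact (mul_eq_zero.1 h1).resolve_left (pow_ne_zero _ hy)
      intro i
      obtain ⟨r, hr⟩ := Polynomial.X_dvd_iff.2 (h q hq0 i)
      exact ⟨r, by rw [hq i, hr, pow_succ, mul_assoc]⟩
  intro i
  by_contra hi
  have h1 := Polynomial.natDegree_le_of_dvd (key ((p i).natDegree + 1) i) hi
  simp at h1

namespace FFPlace

lemma finite_setOf_val_lt_one (hK : FiniteOverTranscendental k K) {y : K} (hy0 : y ≠ 0) :
    {P : FFPlace k K | P.val y < 1}.Finite := by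
  classical
  by_contra hinf
  obtain ⟨P₀, hP₀⟩ := Set.Infinite.nonempty hinf
  have := hK y (P₀.transcendental_of_val_lt_one hy0 hP₀)
  obtain ⟨S, hS, hcard⟩ := Set.Infinite.exists_subset_card_eq hinf (Module.finrank k⟮y⟯ K + 1)
  choose u hu hu' using fun P : FFPlace k K =>
    exists_one_lt_val_forall_val_lt_one hK P (S.erase P) (Finset.notMem_erase P S)
  have h1 : ∀ P Q : FFPlace k K, P ∈ S → Q ∈ S → P ≠ Q → Q.val (u P / (1 + u P)) < 1 := by
    intro P Q _ hQ hPQ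
    have h := hu' P Q (Finset.mem_erase.2 ⟨hPQ.symm, hQ⟩)
    rw [map_div₀, Valuation.map_one_add_of_lt _ h, div_one]
    exact h
  have h2 : ∀ P : FFPlace k K, P.val (u P / (1 + u P)) = 1 := by
    intro P
    rw [map_div₀, Valuation.map_add_eq_of_lt_right, div_self (zero_lt_one.trans (hu P)).ne']
    rw [map_one]; exact hu P
  have hli : LinearIndependent k⟮y⟯ (fun P : S => u P / (1 + u P)) := by
    refine linearIndependent_adjoin_simple_of_coeff_zero hy0 fun p hp P => ?_
    by_contra hcoeff
    have hyP : P.1.val y < 1 := hS P.2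
    rw [← Finset.add_sum_erase _ _ (Finset.mem_univ P)] at hp
    have h3 : P.1.val (Polynomial.aeval y (p P) * (u P / (1 + u P))) = 1 := by
      rw [map_mul, P.1.val_aeval_of_coeff_zero_ne_zero hyP hcoeff, h2, one_mul]
    rw [eq_neg_of_add_eq_zero_left hp, Valuation.map_neg] at h3
    refine absurd h3 (ne_of_lt (Valuation.map_sum_lt _ one_ne_zero fun Q hQ => ?_))
    rw [map_mul]
    refine mul_lt_one_of_nonneg_of_lt_one_right (P.1.val_aeval_le_one hyP.le _) zero_le
      (h1 _ _ Q.2 P.2 ?_)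
    exact fun h => Finset.ne_of_mem_erase hQ (Subtype.ext h)
  have h4 := hli.fintype_card_le_finrank
  rw [Fintype.card_coe, hcard] at h4
  omega

lemma finite_setOf_notMem (hK : FiniteOverTranscendental k K) (x : K) :
    {P : FFPlace k K | x ∉ P.asSubring}.Finite := by
  rcases eq_or_ne x 0 with rfl | hx
  · simp [zero_mem]
  refine (finite_setOf_val_lt_one hK (inv_ne_zero hx)).subset fun P hP => ?_
  rw [Set.mem_ofPred_eq, P.mem_iff, not_le] at hP
  rw [Set.mem_ofPred_eq, map_inv₀]
  exact inv_lt_one_of_one_lt₀ hP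

/-- The `k`-submodule underlying the valuation ring of a place. -/
def toSubmodule (P : FFPlace k K) : Submodule k K where
  carrier := {x | x ∈ P.asSubring}
  zero_mem' := P.asSubring.zero_mem
  add_mem' := P.asSubring.add_mem _ _
  smul_mem' := fun c x hx => by
    show c • x ∈ P.asSubring
    rw [Algebra.smul_def]; exact mul_mem (P.algebraMap_mem c) hx

lemma mem_toSubmodule (P : FFPlace k K) (x : K) : x ∈ P.toSubmodule ↔ P.val x ≤ 1 :=
  Iff.trans Iff.rfl (P.mem_iff x)

/-- A valuation ring is finite-dimensional modulo any of its nonzero principal ideals. -/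
lemma exists_finset_forall_val_sub_le (hK : FiniteOverTranscendental k K) (P : FFPlace k K)
    {y : K} (hy0 : y ≠ 0) :
    ∃ s : Finset K, ∀ x, P.val x ≤ 1 → ∃ z ∈ Submodule.span k (s : Set K),
      P.val (x - z) ≤ P.val y := by
  classical
  rcases le_or_gt 1 (P.val y) with hy | hy
  · exact ⟨∅, fun x hx => ⟨0, zero_mem _, by simpa using hx.trans hy⟩⟩
  have := hK y (P.transcendental_of_val_lt_one hy0 hy)
  let W : Submodule k K := P.toSubmodule.map (LinearMap.mulLeft k y)
  have hW : ∀ x, x ∈ W ↔ P.val x ≤ P.val y := by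
    intro x
    rw [Submodule.mem_map]
    constructor
    · rintro ⟨z, hz, rfl⟩
      rw [LinearMap.mulLeft_apply, map_mul]
      exact mul_le_of_le_one_right zero_le ((P.mem_toSubmodule z).1 hz)
    · intro h
      refine ⟨x / y, (P.mem_toSubmodule _).2 ?_, by simp [mul_div_cancel₀, hy0]⟩
      rw [map_div₀]
      exact div_le_one_of_le₀ h zero_le
  have hfin : Module.Finite k (P.toSubmodule.map W.mkQ) := by
    have hr : Module.rank k (P.toSubmodule.map W.mkQ) ≤ Module.finrank k⟮y⟯ K := by
      refine rank_le fun s hs => ?_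
      choose v hv hvs using fun i : s => (Submodule.mem_map.1 i.1.2)
      have hli : LinearIndependent k⟮y⟯ v := by
        refine linearIndependent_adjoin_simple_of_coeff_zero hy0 fun p hp => ?_
        refine Fintype.linearIndependent_iff.1 hs (fun i => (p i).coeff 0) ?_
        refine Subtype.ext ?_
        rw [Submodule.coe_sum]
        simp only [Submodule.coe_smul, ← hvs, ← map_smul, ← map_sum, ZeroMemClass.coe_zero]
        rw [Submodule.mkQ_apply, Submodule.Quotient.mk_eq_zero, hW]
        have h1 : ∑ i, (p i).coeff 0 • v i
            = - (y * ∑ i, Polynomial.aeval y (p i).divX * v i) := by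
          rw [eq_neg_iff_add_eq_zero, ← hp, Finset.mul_sum, ← Finset.sum_add_distrib]
          refine Finset.sum_congr rfl fun i _ => ?_
          conv_rhs => rw [← Polynomial.divX_mul_X_add (p i)]
          simp [Algebra.smul_def]; ring
        rw [h1, Valuation.map_neg, map_mul]
        refine mul_le_of_le_one_right zero_le (Valuation.map_sum_le _ fun i _ => ?_)
        rw [map_mul]
        exact mul_le_one' (P.val_aeval_le_one hy.le _) ((P.mem_toSubmodule _).1 (hv i))
      simpa using hli.fintype_card_le_finrank
    exact Module.rank_lt_aleph0_iff.1 (hr.trans_lt (Cardinal.natCast_lt_aleph0))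
  obtain ⟨t, ht⟩ := (Submodule.fg_top _).1 hfin.fg_top
  obtain ⟨s, hs⟩ : ∃ s : Finset K, s.image W.mkQ = t := by
    obtain ⟨s, -, hs⟩ := Finset.subset_set_image_iff.1
      (show (t : Set (K ⧸ W)) ⊆ W.mkQ '' Set.univ by
        rw [Set.image_univ, Set.range_eq_univ.2 W.mkQ_surjective]; exact Set.subset_univ _)
    exact ⟨s, hs⟩
  refine ⟨s, fun x hx => ?_⟩
  have h2 : W.mkQ x ∈ Submodule.span k (t : Set (K ⧸ W)) := by
    rw [ht]; exact Submodule.mem_map_of_mem ((P.mem_toSubmodule x).2 hx)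
  rw [← hs, Finset.coe_image, Submodule.span_image, Submodule.mem_map] at h2
  obtain ⟨z, hz, hzx⟩ := h2
  refine ⟨z, hz, (hW _).1 ?_⟩
  rw [← Submodule.Quotient.mk_eq_zero, ← Submodule.mkQ_apply, map_sub, hzx, sub_self]

end FFPlace

end Independence

section Quotients

variable {k V : Type*} [Field k] [AddCommGroup V] [Module k V]

lemma finite_and_finrank_map_mkQ_le {A W : Submodule k V} {s : Finset V}
    (h : A ≤ W ⊔ Submodule.span k (s : Set V)) :
    Module.Finite k (A.map W.mkQ) ∧ Module.finrank k (A.map W.mkQ) ≤ s.card := by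
  classical
  have h1 : A.map W.mkQ ≤ Submodule.span k ((s.image W.mkQ : Finset (V ⧸ W)) : Set (V ⧸ W)) := by
    refine (Submodule.map_mono h).trans ?_
    rw [Submodule.map_sup, Submodule.mkQ_map_self, bot_sup_eq, Finset.coe_image,
      Submodule.span_image]
  exact ⟨Submodule.finiteDimensional_of_le h1, (Submodule.finrank_mono h1).trans
    ((finrank_span_finset_le_card _).trans Finset.card_image_le)⟩

lemma exists_finset_le_sup_span {A W : Submodule k V} [Module.Finite k (A.map W.mkQ)] :
    ∃ s : Finset V, (∀ v ∈ s, v ∈ A) ∧ s.card ≤ Module.finrank k (A.map W.mkQ) ∧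
      A ≤ W ⊔ Submodule.span k (s : Set V) := by
  classical
  let b := Module.finBasis k (A.map W.mkQ)
  choose v hvA hv using fun i => Submodule.mem_map.1 (b i).2
  refine ⟨Finset.univ.image v, ?_, ?_, fun a ha => ?_⟩
  · simpa using hvA
  · exact Finset.card_image_le.trans (by simp)
  · have h1 := b.sum_repr ⟨W.mkQ a, Submodule.mem_map_of_mem ha⟩
    set c := b.repr ⟨W.mkQ a, Submodule.mem_map_of_mem ha⟩
    have h2 : a - ∑ i, c i • v i ∈ W := by
      rw [← Submodule.Quotient.mk_eq_zero, ← Submodule.mkQ_apply, map_sub, map_sum, sub_eq_zero]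
      have := congrArg Subtype.val h1
      rw [Submodule.coe_sum] at this
      refine Eq.trans this.symm ?_
      refine Finset.sum_congr rfl fun i _ => ?_
      rw [Submodule.coe_smul, ← hv i, map_smul]
    rw [← sub_add_cancel a (∑ i, c i • v i)]
    refine add_mem (Submodule.mem_sup_left h2) (Submodule.mem_sup_right ?_)
    exact sum_mem fun i _ => Submodule.smul_mem _ _ (Submodule.subset_span (by simp))

lemma finrank_map_mkQ_sup_add_one_le {A W W' : Submodule k V} [Module.Finite k (A.map W.mkQ)]
    (hWW' : W ≤ W') {v : V} (hvA : v ∈ A) (hvW : v ∉ W) (hvW' : v ∈ W') :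
    Module.Finite k (A.map W'.mkQ) ∧
      Module.finrank k (A.map W'.mkQ) + 1 ≤ Module.finrank k (A.map W.mkQ) := by
  let φ : (V ⧸ W) →ₗ[k] (V ⧸ W') := Submodule.factor hWW'
  have hφ : φ.comp W.mkQ = W'.mkQ := by ext; rfl
  let ψ := φ.domRestrict (A.map W.mkQ)
  have hr : LinearMap.range ψ = A.map W'.mkQ := by
    rw [LinearMap.range_domRestrict, ← Submodule.map_comp, hφ]
  have hk : 0 < Module.finrank k (LinearMap.ker ψ) := by
    have : Nontrivial (LinearMap.ker ψ) := by
      refine ⟨⟨⟨⟨W.mkQ v, Submodule.mem_map_of_mem hvA⟩, ?_⟩, 0, ?_⟩⟩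
      · rw [LinearMap.mem_ker]
        change (φ.comp W.mkQ) v = 0
        rw [hφ, Submodule.mkQ_apply, Submodule.Quotient.mk_eq_zero]
        exact hvW'
      · intro h
        have h1 : W.mkQ v = 0 := congrArg (fun z => z.1.1) h
        rw [Submodule.mkQ_apply, Submodule.Quotient.mk_eq_zero] at h1
        exact hvW h1
    exact Module.finrank_pos (R := k) (M := LinearMap.ker ψ)
  have h1 := LinearMap.finrank_range_add_finrank_ker ψ
  have h2 : Module.Finite k (LinearMap.range ψ) := inferInstance
  rw [hr] at h1 h2
  exact ⟨h2, by omega⟩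

end Quotients

section Adeles

variable {k K : Type*} [Field k] [Field K] [Algebra k K]

/-- The families `α` such that `δ P * α P` is integral at every place `P`. -/
def scaledAdeles (δ : FFPlace k K → K) : Submodule k (FFPlace k K → K) where
  carrier := {α | ∀ P : FFPlace k K, P.val (δ P * α P) ≤ 1}
  zero_mem' := fun P => by simp
  add_mem' := fun {a b} ha hb P => by
    show P.val (δ P * (a P + b P)) ≤ 1
    rw [mul_add]
    exact Valuation.map_add_le _ (ha P) (hb P)
  smul_mem' := fun c a ha P => by
    show P.val (δ P * (c • a P)) ≤ 1
    rw [Algebra.smul_def, mul_left_comm, map_mul]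
    exact mul_le_one' (P.val_algebraMap_le_one c) (ha P)

lemma mem_scaledAdeles {δ α : FFPlace k K → K} :
    α ∈ scaledAdeles δ ↔ ∀ P : FFPlace k K, P.val (δ P * α P) ≤ 1 := Iff.rfl

lemma mem_integralAdeles {α : FFPlace k K → K} :
    α ∈ integralAdeles k K ↔ ∀ P : FFPlace k K, P.val (α P) ≤ 1 :=
  Iff.trans Iff.rfl (forall_congr' fun P => P.mem_iff _)

lemma mem_adeleSubmodule {α : FFPlace k K → K} :
    α ∈ adeleSubmodule k K ↔ {P : FFPlace k K | α P ∉ P.asSubring}.Finite := Iff.rfl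

lemma integralAdeles_eq_scaledAdeles_one : integralAdeles k K = scaledAdeles 1 := by
  ext α; simp [mem_integralAdeles, mem_scaledAdeles]

lemma mem_principalAdeles {α : FFPlace k K → K} :
    α ∈ principalAdeles k K ↔ ∃ x : K, α = fun _ => x := by
  rw [principalAdeles, LinearMap.mem_range]
  exact exists_congr fun x => by rw [eq_comm]; rfl

lemma const_mem_principalAdeles (x : K) :
    (fun _ : FFPlace k K => x) ∈ principalAdeles k K := mem_principalAdeles.2 ⟨x, rfl⟩

lemma genus_eq_finrank_map :
    genus k K = Module.finrank k
      ((adeleSubmodule k K).map (integralAdeles k K ⊔ principalAdeles k K).mkQ) := by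
  let φ := (integralAdeles k K ⊔ principalAdeles k K).mkQ.comp (adeleSubmodule k K).subtype
  have hker : LinearMap.ker φ =
      (integralAdeles k K ⊔ principalAdeles k K).comap (adeleSubmodule k K).subtype := by
    rw [LinearMap.ker_comp, Submodule.ker_mkQ]
  have hrange : LinearMap.range φ =
      (adeleSubmodule k K).map (integralAdeles k K ⊔ principalAdeles k K).mkQ := by
    rw [LinearMap.range_comp, Submodule.range_subtype]
  rw [genus, ← hker, ← hrange]
  exact φ.quotKerEquivRange.finrank_eq

lemma genus_le_card {s : Finset (FFPlace k K → K)} (h : adeleSubmodule k K ≤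
    (integralAdeles k K ⊔ principalAdeles k K) ⊔ Submodule.span k (s : Set (FFPlace k K → K))) :
    genus k K ≤ s.card := by
  rw [genus_eq_finrank_map]
  exact (finite_and_finrank_map_mkQ_le h).2

/-- The integral adeles are finite-dimensional modulo `scaledAdeles δ`, for `δ` an idele. -/
lemma exists_integralAdeles_le_scaledAdeles_sup_span (hK : FiniteOverTranscendental k K)
    {δ : FFPlace k K → K} (hδ0 : ∀ P, δ P ≠ 0) (hδ : {P : FFPlace k K | P.val (δ P) ≠ 1}.Finite) :
    ∃ s : Finset (FFPlace k K → K), integralAdeles k K ≤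
      scaledAdeles δ ⊔ Submodule.span k (s : Set (FFPlace k K → K)) := by
  classical
  choose t ht using fun P : FFPlace k K =>
    P.exists_finset_forall_val_sub_le hK (inv_ne_zero (hδ0 P))
  refine ⟨hδ.toFinset.biUnion fun P => (t P).image fun x => Pi.single P x, fun α hα => ?_⟩
  rw [mem_integralAdeles] at hα
  choose z hz hz' using fun P => ht P (α P) (hα P)
  rw [← sub_add_cancel α (∑ P ∈ hδ.toFinset, Pi.single P (z P))]
  refine add_mem (Submodule.mem_sup_left ?_) (Submodule.mem_sup_right ?_)
  · intro P
    rw [Pi.sub_apply, Finset.sum_apply, Finset.sum_pi_single]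
    by_cases hP : P ∈ hδ.toFinset
    · rw [if_pos hP, map_mul]
      refine (mul_le_mul_right (hz' P) _).trans ?_
      rw [← map_mul, mul_inv_cancel₀ (hδ0 P), map_one]
    · rw [if_neg hP, sub_zero, map_mul]
      have h1 : P.val (δ P) = 1 := by simpa using hP
      rw [h1, one_mul]
      exact hα P
  · refine sum_mem fun P hP => ?_
    have h1 : LinearMap.single k (fun _ : FFPlace k K => K) P (z P) ∈
        (Submodule.span k (t P : Set K)).map (LinearMap.single k (fun _ => K) P) :=
      Submodule.mem_map_of_mem (hz P)
    rw [← Submodule.span_image] at h1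
    refine Submodule.span_mono ?_ h1
    rintro _ ⟨x, hx, rfl⟩
    rw [Finset.coe_biUnion]
    exact Set.mem_biUnion hP (Finset.mem_coe.2 (Finset.mem_image_of_mem _ hx))

end Adeles

section Pushforward

variable {k K L : Type*} [Field k] [Field K] [Field L] [Algebra k K] [Algebra k L] [Algebra K L]
  [IsScalarTower k K L]

lemma FiniteOverTranscendental.of_tower (hL : FiniteOverTranscendental k L) :
    FiniteOverTranscendental k K := by
  intro y hy
  have hy' : Transcendental k (algebraMap K L y) :=
    (transcendental_algebraMap_iff (algebraMap K L).injective).2 hy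
  have := hL _ hy'
  let e : k⟮y⟯ ≃ₐ[k] k⟮algebraMap K L y⟯ :=
    (k⟮y⟯.equivMap (IsScalarTower.toAlgHom k K L)).trans
      (IntermediateField.equivOfEq (by rw [adjoin_map, Set.image_singleton]; rfl))
  have hfin : Module.Finite k⟮y⟯ L := by
    refine Module.Finite.of_equiv_equiv (A₁ := k⟮algebraMap K L y⟯) (B₁ := L)
      e.symm.toRingEquiv (RingEquiv.refl L) ?_
    ext z
    obtain ⟨z, rfl⟩ := e.surjective z
    simp only [RingHom.comp_apply, RingEquiv.coe_toRingHom, RingEquiv.refl_apply]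
    rw [show e.symm.toRingEquiv (e z) = z from e.symm_apply_apply z]
    rfl
  exact Module.Finite.of_injective (IsScalarTower.toAlgHom k⟮y⟯ K L).toLinearMap
    (algebraMap K L).injective

namespace FFPlace

variable (K) in
/-- The place of `K` below a place of an algebraic extension `L`. -/
def restrict [Algebra.IsAlgebraic K L] (Q : FFPlace k L) : FFPlace k K where
  asSubring := Q.asSubring.comap (algebraMap K L)
  algebraMap_mem a := by
    rw [ValuationSubring.mem_comap, ← IsScalarTower.algebraMap_apply]
    exact Q.algebraMap_mem a
  ne_top h := by
    refine Q.ne_top (eq_top_iff.2 fun x _ => ?_)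
    have hK : ∀ y : K, algebraMap K L y ∈ Q.asSubring := fun y => by
      rw [← ValuationSubring.mem_comap, h]; trivial
    let P : FFPlace K L := ⟨Q.asSubring, hK, Q.ne_top⟩
    exact P.mem_of_isAlgebraic (Algebra.IsAlgebraic.isAlgebraic x)

variable [Algebra.IsAlgebraic K L]

lemma val_algebraMap_le_one_iff (Q : FFPlace k L) (x : K) :
    Q.val (algebraMap K L x) ≤ 1 ↔ (Q.restrict K).val x ≤ 1 := by
  rw [← mem_iff, ← mem_iff]; rfl

lemma val_algebraMap_lt_one_iff (Q : FFPlace k L) (x : K) :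
    Q.val (algebraMap K L x) < 1 ↔ (Q.restrict K).val x < 1 := by
  rcases eq_or_ne x 0 with rfl | hx
  · simp
  have h := (Q.val_algebraMap_le_one_iff x⁻¹).not
  rw [map_inv₀, map_inv₀, map_inv₀,
    inv_le_one₀ (zero_lt_iff.2 ((Valuation.ne_zero_iff _).2 (by simpa using hx))),
    inv_le_one₀ (zero_lt_iff.2 ((Valuation.ne_zero_iff _).2 hx)), not_le, not_le] at h
  exact h

lemma finite_setOf_restrict_eq (hL : FiniteOverTranscendental k L) (P : FFPlace k K) :
    {Q : FFPlace k L | Q.restrict K = P}.Finite := by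
  obtain ⟨y, hy0, hy⟩ := P.exists_val_lt_one
  refine (finite_setOf_val_lt_one hL
    (y := algebraMap K L y) (by simpa using hy0)).subset ?_
  rintro Q rfl
  exact (Q.val_algebraMap_lt_one_iff y).2 hy

end FFPlace

variable [Algebra.IsAlgebraic K L]

/-- Pulling back families of elements along the restriction of places, scaled by `w`. -/
noncomputable def scaledPullback (w : L) : (FFPlace k K → K) →ₗ[k] (FFPlace k L → L) where
  toFun α Q := algebraMap K L (α (Q.restrict K)) * w
  map_add' α β := by ext Q; simp [add_mul]
  map_smul' c α := by ext Q; simp [Algebra.smul_def, mul_assoc, ← IsScalarTower.algebraMap_apply]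

lemma scaledPullback_apply (w : L) (α : FFPlace k K → K) (Q : FFPlace k L) :
    scaledPullback w α Q = algebraMap K L (α (Q.restrict K)) * w := rfl

/-- The adeles of `L` modulo integral adeles are spanned by adeles of `K`. -/
lemma adeleSubmodule_le_sup_iSup_map (hL : FiniteOverTranscendental k L) {ι : Type*} [Fintype ι]
    {w : ι → L} (hw : Submodule.span K (Set.range w) = ⊤) :
    adeleSubmodule k L ≤ integralAdeles k L ⊔
      ⨆ i, (adeleSubmodule k K).map (scaledPullback (w i)) := by
  classical
  intro α hα
  have hex : ∀ P : FFPlace k K, ∃ c : ι → K,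
      (∀ Q : FFPlace k L, Q.restrict K = P → Q.val (∑ i, c i • w i - α Q) ≤ 1) ∧
      ((∀ Q : FFPlace k L, Q.restrict K = P → Q.val (α Q) ≤ 1) → c = 0) := by
    intro P
    by_cases hP : ∀ Q : FFPlace k L, Q.restrict K = P → Q.val (α Q) ≤ 1
    · exact ⟨0, fun Q hQ => by simpa using hP Q hQ, fun _ => rfl⟩
    · obtain ⟨x, hx⟩ := FFPlace.exists_forall_val_sub_le_one hL
        (FFPlace.finite_setOf_restrict_eq hL P).toFinset α
      obtain ⟨c, rfl⟩ := (Submodule.mem_span_range_iff_exists_fun K).1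
        (hw ▸ Submodule.mem_top : x ∈ Submodule.span K (Set.range w))
      exact ⟨c, fun Q hQ => hx Q (by simpa using hQ), fun h => absurd h hP⟩
  choose c hc hc0 using hex
  rw [← sub_add_cancel α (∑ i, scaledPullback (w i) fun P => c P i)]
  refine add_mem (Submodule.mem_sup_left ?_) (Submodule.mem_sup_right ?_)
  · rw [mem_integralAdeles]
    intro Q
    have h := hc (Q.restrict K) Q rfl
    rw [Pi.sub_apply, Finset.sum_apply, Valuation.map_sub_swap]
    simpa [scaledPullback_apply, Algebra.smul_def] using h
  · refine sum_mem fun i _ => Submodule.mem_iSup_of_mem i (Submodule.mem_map_of_mem ?_)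
    refine ((mem_adeleSubmodule.1 hα).image (FFPlace.restrict K)).subset fun P hP => ?_
    by_contra hP'
    refine hP ?_
    show c P i ∈ P.asSubring
    rw [hc0 P, Pi.zero_apply]
    · exact zero_mem _
    · intro Q hQ
      by_contra hQ'
      exact hP' ⟨Q, (Q.mem_iff _).not.2 hQ', hQ⟩

/-- Generators for the adeles of `L` modulo integral and principal ones, from such generators
over `K`. -/
lemma exists_adeleSubmodule_le_sup_span_of_tower (hL : FiniteOverTranscendental k L) {ι : Type*}
    [Fintype ι] {w : ι → L} (hw : Submodule.span K (Set.range w) = ⊤)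
    {δ : ι → FFPlace k K → K}
    (hδ : ∀ i (Q : FFPlace k L), Q.val (w i) ≤ Q.val (algebraMap K L (δ i (Q.restrict K))))
    (s : ι → Finset (FFPlace k K → K))
    (hs : ∀ i, adeleSubmodule k K ≤ (scaledAdeles (δ i) ⊔ principalAdeles k K) ⊔
      Submodule.span k (s i : Set (FFPlace k K → K))) :
    ∃ t : Finset (FFPlace k L → L), t.card ≤ ∑ i, (s i).card ∧
      adeleSubmodule k L ≤ (integralAdeles k L ⊔ principalAdeles k L) ⊔
        Submodule.span k (t : Set (FFPlace k L → L)) := by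
  classical
  refine ⟨Finset.univ.biUnion fun i => (s i).image (scaledPullback (w i)),
    Finset.card_biUnion_le.trans (Finset.sum_le_sum fun i _ => Finset.card_image_le), ?_⟩
  refine (adeleSubmodule_le_sup_iSup_map hL hw).trans
    (sup_le (le_sup_left.trans le_sup_left) (iSup_le fun i => ?_))
  refine (Submodule.map_mono (hs i)).trans ?_
  rw [Submodule.map_sup, Submodule.map_sup]
  refine sup_le_sup (sup_le_sup ?_ ?_) ?_
  · rintro _ ⟨α, hα, rfl⟩
    rw [mem_integralAdeles]
    intro Q
    rw [scaledPullback_apply, map_mul]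
    refine (mul_le_mul_right (hδ i Q) _).trans ?_
    rw [← map_mul, ← map_mul, Q.val_algebraMap_le_one_iff, mul_comm]
    exact hα _
  · rintro _ ⟨α, hα, rfl⟩
    obtain ⟨x, rfl⟩ := mem_principalAdeles.1 hα
    exact mem_principalAdeles.2 ⟨_, rfl⟩
  · rw [← Submodule.span_image]
    refine Submodule.span_mono ?_
    rintro _ ⟨α, hα, rfl⟩
    rw [Finset.coe_biUnion]
    exact Set.mem_biUnion (Finset.mem_coe.2 (Finset.mem_univ i))
      (Finset.mem_coe.2 (Finset.mem_image_of_mem _ hα))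

end Pushforward

section Rational

variable {k K : Type*} [Field k] [Field K] [Algebra k K]

namespace FFPlace

lemma val_aeval_of_one_lt (P : FFPlace k K) {t : K} (ht : 1 < P.val t) {p : Polynomial k}
    (hp : p ≠ 0) : P.val (Polynomial.aeval t p) = P.val t ^ p.natDegree := by
  have ht0 : t ≠ 0 := by rintro rfl; simp at ht
  have hti : P.val t⁻¹ < 1 := by rw [map_inv₀]; exact inv_lt_one_of_one_lt₀ ht
  let _ : Invertible t := invertibleOfNonzero ht0
  have h := Polynomial.eval₂_reverse_mul_pow (algebraMap k K) t p
  rw [invOf_eq_inv, ← Polynomial.aeval_def, ← Polynomial.aeval_def] at h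
  rw [← h, map_mul, map_pow, P.val_aeval_of_coeff_zero_ne_zero hti, one_mul]
  rwa [Polynomial.coeff_zero_reverse, Polynomial.leadingCoeff_ne_zero]

variable (t : K)

/-- The polynomials in `t` vanishing at the place `P`. -/
def polyIdeal (P : FFPlace k K) (ht : P.val t ≤ 1) : Ideal (Polynomial k) where
  carrier := {p | P.val (Polynomial.aeval t p) < 1}
  zero_mem' := by simp
  add_mem' := fun {p q} hp hq => by
    show P.val (Polynomial.aeval t (p + q)) < 1
    rw [map_add]; exact Valuation.map_add_lt _ hp hq
  smul_mem' := fun p q hq => by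
    show P.val (Polynomial.aeval t (p * q)) < 1
    rw [map_mul, map_mul]
    exact mul_lt_one_of_nonneg_of_lt_one_right (P.val_aeval_le_one ht p) zero_le hq

variable {t}

lemma mem_polyIdeal (P : FFPlace k K) (ht : P.val t ≤ 1) {p : Polynomial k} :
    p ∈ P.polyIdeal t ht ↔ P.val (Polynomial.aeval t p) < 1 := Iff.rfl

lemma val_aeval_eq_one (P : FFPlace k K) (ht : P.val t ≤ 1) {p : Polynomial k}
    (hp : p ∉ P.polyIdeal t ht) : P.val (Polynomial.aeval t p) = 1 :=
  (P.val_aeval_le_one ht p).eq_of_not_lt hp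

lemma exists_aeval_div_aeval_eq (hgen : k⟮t⟯ = ⊤) (x : K) :
    ∃ p q : Polynomial k, IsCoprime p q ∧ q ≠ 0 ∧
      x = Polynomial.aeval t p / Polynomial.aeval t q := by
  obtain ⟨p, q, hx⟩ := (mem_adjoin_simple_iff k x).1 (hgen ▸ IntermediateField.mem_top : x ∈ k⟮t⟯)
  rcases eq_or_ne (Polynomial.aeval t q) 0 with hq | hq
  · exact ⟨0, 1, isCoprime_one_right, one_ne_zero, by rw [hx, hq]; simp⟩
  have hq0 : q ≠ 0 := by rintro rfl; simp at hq
  classical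
  obtain ⟨g, A, B, p', q', hp', hq', h⟩ : ∃ g A B p' q' : Polynomial k,
      p = g * p' ∧ q = g * q' ∧ g = p * A + q * B :=
    ⟨_, _, _, _, _, (EuclideanDomain.gcd_dvd_left p q).choose_spec,
      (EuclideanDomain.gcd_dvd_right p q).choose_spec, EuclideanDomain.gcd_eq_gcd_ab p q⟩
  have hg : g ≠ 0 := fun hg => hq0 (by rw [hq', hg, zero_mul])
  refine ⟨p', q', ⟨A, B, mul_left_cancel₀ hg ?_⟩, ?_, ?_⟩
  · have h1 : g * (A * p' + B * q') = (g * p') * A + (g * q') * B := by ring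
    rw [h1, ← hp', ← hq', mul_one, ← h]
  · rintro rfl; exact hq0 (by rw [hq', mul_zero])
  · rw [hq', map_mul] at hq
    rw [hx, hp', hq', map_mul, map_mul]
    exact mul_div_mul_left _ _ (left_ne_zero_of_mul hq)

lemma exists_generator_polyIdeal (hgen : k⟮t⟯ = ⊤) (P : FFPlace k K) (ht : P.val t ≤ 1) :
    ∃ π : Polynomial k, Irreducible π ∧ ∀ p, p ∈ P.polyIdeal t ht ↔ π ∣ p := by
  have hprime : (P.polyIdeal t ht).IsPrime := by
    refine ⟨fun h => ?_, fun {p q} hpq => ?_⟩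
    · have h1 := (Ideal.eq_top_iff_one _).1 h
      rw [mem_polyIdeal, map_one, map_one] at h1
      exact lt_irrefl _ h1
    · by_contra! h
      rw [mem_polyIdeal, map_mul, map_mul, P.val_aeval_eq_one ht h.1, P.val_aeval_eq_one ht h.2,
        one_mul] at hpq
      exact lt_irrefl _ hpq
  have hbot : P.polyIdeal t ht ≠ ⊥ := by
    intro h
    refine P.ne_top (eq_top_iff.2 fun x _ => ?_)
    obtain ⟨p, q, -, hq, rfl⟩ := exists_aeval_div_aeval_eq hgen x
    rw [P.mem_iff, map_div₀, P.val_aeval_eq_one ht (p := q), div_one]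
    · exact P.val_aeval_le_one ht p
    · rwa [h, Ideal.mem_bot]
  refine ⟨Submodule.IsPrincipal.generator (P.polyIdeal t ht),
    (Submodule.IsPrincipal.prime_generator_of_isPrime _ hbot).irreducible, fun p =>
    Submodule.IsPrincipal.mem_iff_generator_dvd _⟩

/-- On a rational function field every principal part at one place is that of a function regular
at all other places. -/
lemma exists_val_sub_le_one_forall_ne_of_val_le_one (hgen : k⟮t⟯ = ⊤)
    (htr : Transcendental k t) (hK : FiniteOverTranscendental k K) (P : FFPlace k K)
    (ht : P.val t ≤ 1) (x : K) :
    ∃ z : K, P.val (z - x) ≤ 1 ∧ ∀ Q : FFPlace k K, Q ≠ P → Q.val z ≤ 1 := by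
  obtain ⟨π, hπ, hmem⟩ := P.exists_generator_polyIdeal hgen ht
  obtain ⟨a, q, -, hq, rfl⟩ := exists_aeval_div_aeval_eq hgen x
  obtain ⟨b, hb, hbπ⟩ :=
    (FiniteMultiplicity.of_prime_left hπ.prime hq).exists_eq_pow_mul_and_not_dvd
  set n := multiplicity π q
  have hb1 : P.val (Polynomial.aeval t b) = 1 := P.val_aeval_eq_one ht ((hmem b).not.2 hbπ)
  have hb0 : Polynomial.aeval t b ≠ 0 := by
    rw [← Valuation.ne_zero_iff P.val, hb1]; exact one_ne_zero
  have hπ0 : ∀ r : Polynomial k, r ≠ 0 → Polynomial.aeval t r ≠ 0 := fun r hr h0 =>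
    hr (transcendental_iff.1 htr r h0)
  obtain ⟨u, v, huv⟩ : IsCoprime (π ^ n) b := ((hπ.coprime_iff_not_dvd).2 hbπ).pow_left
  set c := (a * v) % π ^ n with hc
  have hac : a * v = π ^ n * (a * v / π ^ n) + c := (EuclideanDomain.div_add_mod _ _).symm
  set e := a * v / π ^ n with he
  have hπn : Polynomial.aeval t (π ^ n) ≠ 0 := hπ0 _ (pow_ne_zero _ hπ.ne_zero)
  refine ⟨Polynomial.aeval t c / Polynomial.aeval t (π ^ n), ?_, fun Q hQ => ?_⟩
  · have h1 : Polynomial.aeval t c / Polynomial.aeval t (π ^ n) -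
        Polynomial.aeval t a / Polynomial.aeval t q =
        - (Polynomial.aeval t (e * b + a * u) / Polynomial.aeval t b) := by
      rw [hb, map_mul]
      field_simp
      rw [← map_mul, ← map_sub, ← map_mul, ← map_neg]
      congr 1
      linear_combination (-b) * hac + a * huv
    rw [h1, Valuation.map_neg, map_div₀, hb1, div_one]
    exact P.val_aeval_le_one ht _
  · rcases le_or_gt (Q.val t) 1 with hQt | hQt
    · have hπQ : π ∉ Q.polyIdeal t hQt := by
        intro hmemQ
        have hle : ∀ p, p ∈ Q.polyIdeal t hQt → p ∈ P.polyIdeal t ht := by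
          intro p hp
          by_contra hpP
          obtain ⟨u', v', h'⟩ := (hπ.coprime_iff_not_dvd).2 ((hmem p).not.1 hpP)
          have h1 : (1 : Polynomial k) ∈ Q.polyIdeal t hQt := by
            rw [← h']
            exact add_mem (Ideal.mul_mem_left _ _ hmemQ) (Ideal.mul_mem_left _ _ hp)
          rw [mem_polyIdeal, map_one, map_one] at h1
          exact lt_irrefl _ h1
        obtain ⟨x, hxP, hxQ⟩ := exists_val_le_one_lt_val hK hQ.symm
        obtain ⟨p, r, hpr, hr, rfl⟩ := exists_aeval_div_aeval_eq hgen x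
        rcases Classical.em (r ∈ Q.polyIdeal t hQt) with hrQ | hrQ
        · have hrP := hle r hrQ
          have hpP : p ∉ P.polyIdeal t ht := by
            intro hpP
            obtain ⟨u', v', h'⟩ := hpr
            have h1 : (1 : Polynomial k) ∈ P.polyIdeal t ht := by
              rw [← h']
              exact add_mem (Ideal.mul_mem_left _ _ hpP) (Ideal.mul_mem_left _ _ hrP)
            rw [mem_polyIdeal, map_one, map_one] at h1
            exact lt_irrefl _ h1
          rw [map_div₀, P.val_aeval_eq_one ht hpP, one_div, inv_le_one₀ (zero_lt_iff.2
            ((Valuation.ne_zero_iff _).2 (hπ0 r hr)))] at hxP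
          exact absurd hrP hxP.not_gt
        · rw [map_div₀, Q.val_aeval_eq_one hQt hrQ, div_one] at hxQ
          exact absurd (Q.val_aeval_le_one hQt p) hxQ.not_ge
      rw [map_div₀, map_pow, map_pow, Q.val_aeval_eq_one hQt hπQ, one_pow, div_one]
      exact Q.val_aeval_le_one hQt c
    · rcases eq_or_ne c 0 with h0 | h0
      · rw [h0]; simp
      rw [map_div₀, Q.val_aeval_of_one_lt hQt h0,
        Q.val_aeval_of_one_lt hQt (pow_ne_zero _ hπ.ne_zero)]
      refine div_le_one_of_le₀ (pow_le_pow_right₀ hQt.le ?_) zero_le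
      exact Polynomial.natDegree_le_natDegree
        (EuclideanDomain.mod_lt (a * v) (pow_ne_zero n hπ.ne_zero)).le

lemma exists_val_sub_le_one_forall_ne (hgen : k⟮t⟯ = ⊤) (htr : Transcendental k t)
    (hK : FiniteOverTranscendental k K) (P : FFPlace k K) (x : K) :
    ∃ z : K, P.val (z - x) ≤ 1 ∧ ∀ Q : FFPlace k K, Q ≠ P → Q.val z ≤ 1 := by
  rcases le_or_gt (P.val t) 1 with ht | ht
  · exact exists_val_sub_le_one_forall_ne_of_val_le_one hgen htr hK P ht x
  · refine exists_val_sub_le_one_forall_ne_of_val_le_one (t := t⁻¹) ?_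
      (fun h => htr (by simpa using h.inv)) hK P ?_ x
    · rw [eq_top_iff, ← hgen, IntermediateField.adjoin_simple_le_iff]
      have h := inv_mem (IntermediateField.mem_adjoin_simple_self k t⁻¹)
      rwa [inv_inv] at h
    · rw [map_inv₀]; exact (inv_lt_one_of_one_lt₀ ht).le

end FFPlace

/-- A rational function field has genus zero. -/
lemma adeleSubmodule_le_of_adjoin_simple_eq_top {t : K} (hgen : k⟮t⟯ = ⊤)
    (htr : Transcendental k t) (hK : FiniteOverTranscendental k K) :
    adeleSubmodule k K ≤ integralAdeles k K ⊔ principalAdeles k K := by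
  classical
  intro α hα
  rw [mem_adeleSubmodule] at hα
  choose z hz hz' using fun P : FFPlace k K => P.exists_val_sub_le_one_forall_ne hgen htr hK (α P)
  rw [← sub_add_cancel α (fun _ => ∑ P ∈ hα.toFinset, z P)]
  refine add_mem (Submodule.mem_sup_left ?_)
    (Submodule.mem_sup_right (const_mem_principalAdeles _))
  rw [mem_integralAdeles]
  intro P
  rw [Pi.sub_apply, Valuation.map_sub_swap]
  by_cases hP : P ∈ hα.toFinset
  · rw [← Finset.add_sum_erase _ z hP, add_sub_right_comm]
    exact Valuation.map_add_le _ (hz P) (Valuation.map_sum_le _ fun Q hQ =>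
      hz' Q P (Finset.ne_of_mem_erase hQ).symm)
  · refine Valuation.map_sub_le _ (Valuation.map_sum_le _ fun Q hQ => hz' Q P ?_) ?_
    · rintro rfl; exact hP hQ
    · rw [← P.mem_iff]; simpa using hP

end Rational

section FiniteGenus

variable {k K L : Type*} [Field k] [Field K] [Field L] [Algebra k K] [Algebra k L] [Algebra K L]
  [IsScalarTower k K L]

/-- A basis of a finite extension is integral up to an idele of the base. -/
lemma exists_idele_forall_val_le [FiniteDimensional K L] (hL : FiniteOverTranscendental k L)
    {ι : Type*} [Fintype ι] (w : ι → L) :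
    ∃ δ : FFPlace k K → K, (∀ P, δ P ≠ 0) ∧ {P : FFPlace k K | P.val (δ P) ≠ 1}.Finite ∧
      ∀ i (Q : FFPlace k L), Q.val (w i) ≤ Q.val (algebraMap K L (δ (Q.restrict K))) := by
  classical
  have hTfin : {Q : FFPlace k L | ∃ i, w i ∉ Q.asSubring}.Finite := by
    rw [show {Q : FFPlace k L | ∃ i, w i ∉ Q.asSubring} =
      ⋃ i, {Q : FFPlace k L | w i ∉ Q.asSubring} by ext; simp]
    exact Set.finite_iUnion fun i => FFPlace.finite_setOf_notMem hL (w i)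
  set T := hTfin.toFinset with hT
  have hex : ∀ P : FFPlace k K, ∃ x : K, x ≠ 0 ∧
      (∀ i (Q : FFPlace k L), Q.restrict K = P → Q.val (w i) ≤ Q.val (algebraMap K L x)) ∧
      (P ∉ T.image (FFPlace.restrict K) → x = 1) := by
    intro P
    by_cases hP : P ∈ T.image (FFPlace.restrict K)
    · obtain ⟨y, hy0, hy⟩ := P.exists_val_lt_one
      have hn : ∀ (Q : FFPlace k L) i, Q.restrict K = P → ∃ n : ℕ, ∀ m ≥ n,
          Q.val (algebraMap K L y ^ m * w i) ≤ 1 := by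
        intro Q i hQ
        have hyQ : Q.val (algebraMap K L y) < 1 := (Q.val_algebraMap_lt_one_iff y).2 (hQ ▸ hy)
        obtain ⟨n, hn⟩ := Q.exists_pow_mul_lt_one hL (by simpa using hy0) hyQ (w i)
        exact ⟨n, fun m hm => by rw [map_mul, map_pow]; exact (hn m hm).le⟩
      choose n hn using hn
      let F := (FFPlace.finite_setOf_restrict_eq hL P).toFinset
      obtain ⟨N, hN⟩ : ∃ N, ∀ (Q : FFPlace k L) i (h : Q.restrict K = P), n Q i h ≤ N := by
        refine ⟨∑ Q ∈ F, ∑ i, if h : Q.restrict K = P then n Q i h else 0, fun Q i h => ?_⟩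
        refine le_trans ?_ (Finset.single_le_sum (fun _ _ => Nat.zero_le _)
          (show Q ∈ F by simpa [F] using h))
        refine le_trans ?_ (Finset.single_le_sum (fun _ _ => Nat.zero_le _) (Finset.mem_univ i))
        rw [dif_pos h]
      refine ⟨(y ^ N)⁻¹, inv_ne_zero (pow_ne_zero _ hy0), fun i Q hQ => ?_, fun h => absurd hP h⟩
      have h := hn Q i hQ N (hN Q i hQ)
      rw [map_inv₀, map_inv₀, map_pow]
      rw [map_mul] at h
      refine le_of_le_of_eq ((le_inv_mul_iff₀ (zero_lt_iff.2 ?_)).2 h) (mul_one _)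
      exact (Valuation.ne_zero_iff _).2 (pow_ne_zero _ (by simpa using hy0))
    · refine ⟨1, one_ne_zero, fun i Q hQ => ?_, fun _ => rfl⟩
      rw [map_one, map_one, ← Q.mem_iff]
      by_contra h
      exact hP (Finset.mem_image.2 ⟨Q, by rw [hT, Set.Finite.mem_toFinset]; exact ⟨i, h⟩, hQ⟩)
  choose δ h0 h1 h2 using hex
  refine ⟨δ, h0, (T.image (FFPlace.restrict K)).finite_toSet.subset fun P hP => ?_,
    fun i Q => h1 _ i Q rfl⟩
  by_contra h
  exact hP (by rw [h2 P h, map_one])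

/-- The adeles modulo integral and principal ones are finite-dimensional. -/
lemma exists_adeleSubmodule_le_sup_span (hL : FiniteOverTranscendental k L) {x : L}
    (hx : Transcendental k x) :
    ∃ t : Finset (FFPlace k L → L),
      adeleSubmodule k L ≤ (integralAdeles k L ⊔ principalAdeles k L) ⊔
        Submodule.span k (t : Set (FFPlace k L → L)) := by
  have := hL x hx
  have hK : FiniteOverTranscendental k k⟮x⟯ := .of_tower (L := L) hL
  let b := Module.finBasis k⟮x⟯ L
  obtain ⟨δ, h0, hfin, hδ⟩ := exists_idele_forall_val_le (K := k⟮x⟯) hL b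
  obtain ⟨s, hs⟩ := exists_integralAdeles_le_scaledAdeles_sup_span hK h0 hfin
  have hgen : k⟮AdjoinSimple.gen k x⟯ = ⊤ := by
    apply IntermediateField.lift_injective
    rw [IntermediateField.lift_adjoin_simple, IntermediateField.lift_top,
      AdjoinSimple.coe_gen]
  have htr : Transcendental k (AdjoinSimple.gen k x) := by
    rw [← transcendental_algebraMap_iff (algebraMap k⟮x⟯ L).injective]
    exact hx
  obtain ⟨t, -, ht⟩ := exists_adeleSubmodule_le_sup_span_of_tower hL b.span_eq
    (δ := fun _ => δ) hδ (fun _ => s) fun _ => by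
      refine (adeleSubmodule_le_of_adjoin_simple_eq_top hgen htr hK).trans ?_
      rw [sup_right_comm]
      exact sup_le_sup_right hs _
  exact ⟨t, ht⟩

end FiniteGenus

section MinpolyGenerators

variable {k K L : Type*} [Field k] [Field K] [Field L] [Algebra k K] [Algebra k L] [Algebra K L]

lemma FFPlace.exists_notMem_of_transcendental {x : K} (hx : Transcendental k x) :
    ∃ P : FFPlace k K, x ∉ P.asSubring := by
  have : IsIntegrallyClosedIn (integralClosure k K).toSubring K :=
    inferInstanceAs (IsIntegrallyClosedIn (integralClosure k K) K)
  obtain ⟨V, hV, hxV⟩ := Subring.exists_le_valuationSubring_of_isIntegrallyClosedIn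
    (R := (integralClosure k K).toSubring) (x := x)
    (fun h => hx (IsIntegral.isAlgebraic h))
  refine ⟨⟨V, fun a => hV ((integralClosure k K).algebraMap_mem a), ?_⟩, hxV⟩
  rintro rfl
  exact hxV trivial

/-- A coefficient of maximal absolute value, for every place. -/
lemma exists_dominant_coeff (μ : Polynomial K) :
    ∃ a : FFPlace k K → K, (∀ P, ∃ i, a P = μ.coeff i) ∧
      ∀ (P : FFPlace k K) i, P.val (μ.coeff i) ≤ P.val (a P) := by
  have hex : ∀ P : FFPlace k K, ∃ i, ∀ j, P.val (μ.coeff j) ≤ P.val (μ.coeff i) := by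
    intro P
    obtain ⟨i, -, hi⟩ := Finset.exists_max_image (Finset.range (μ.natDegree + 1))
      (fun i => P.val (μ.coeff i)) ⟨0, by simp⟩
    refine ⟨i, fun j => ?_⟩
    by_cases hj : j ∈ Finset.range (μ.natDegree + 1)
    · exact hi j hj
    · rw [Polynomial.coeff_eq_zero_of_natDegree_lt (by simpa [Nat.lt_succ_iff] using hj), map_zero]
      exact zero_le
  choose i hi using hex
  exact ⟨fun P => μ.coeff (i P), fun P => ⟨_, rfl⟩, hi⟩

lemma Polynomial.Monic.one_le_val_of_forall_coeff_le {μ : Polynomial K} (hμ : μ.Monic)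
    {P : FFPlace k K} {a : K} (ha : ∀ i, P.val (μ.coeff i) ≤ P.val a) : 1 ≤ P.val a := by
  simpa [hμ.coeff_natDegree] using ha μ.natDegree

lemma finite_setOf_val_ne_one_of_dominant_coeff (hK : FiniteOverTranscendental k K)
    {μ : Polynomial K} (hμ : μ.Monic) {a : FFPlace k K → K} (ha : ∀ P, ∃ i, a P = μ.coeff i)
    (hmax : ∀ (P : FFPlace k K) i, P.val (μ.coeff i) ≤ P.val (a P)) :
    {P : FFPlace k K | P.val (a P) ≠ 1}.Finite := by
  refine (Set.Finite.biUnion (Finset.finite_toSet (Finset.range (μ.natDegree + 1)))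
    fun i _ => FFPlace.finite_setOf_notMem hK (μ.coeff i)).subset fun P hP => ?_
  obtain ⟨i, hi⟩ := ha P
  have h1 : 1 < P.val (a P) :=
    lt_of_le_of_ne (hμ.one_le_val_of_forall_coeff_le (hmax P)) (Ne.symm hP)
  rw [Set.mem_iUnion₂]
  refine ⟨i, ?_, ?_⟩
  · by_contra h
    rw [hi, Polynomial.coeff_eq_zero_of_natDegree_lt (by simpa [Nat.lt_succ_iff] using h)] at h1
    simp at h1
  · show μ.coeff i ∉ P.asSubring
    rw [P.mem_iff, ← hi]
    exact h1.not_ge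

/-- The value at `f` of the `t`-fold truncation `divX` of a polynomial. -/
noncomputable def truncEval (μ : Polynomial K) (f : L) (t : ℕ) : L :=
  Polynomial.aeval f (Polynomial.divX^[t] μ)

lemma coeff_iterate_divX (μ : Polynomial K) (t j : ℕ) :
    (Polynomial.divX^[t] μ).coeff j = μ.coeff (j + t) := by
  induction t generalizing j with
  | zero => rfl
  | succ t ih =>
    rw [Function.iterate_succ_apply', Polynomial.coeff_divX, ih, add_right_comm, add_assoc]

lemma truncEval_eq (μ : Polynomial K) (f : L) (t : ℕ) :
    truncEval μ f t = f * truncEval μ f (t + 1) + algebraMap K L (μ.coeff t) := by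
  have h := congrArg (Polynomial.aeval f) (Polynomial.divX_mul_X_add (Polynomial.divX^[t] μ))
  rw [map_add, map_mul, Polynomial.aeval_X, Polynomial.aeval_C, coeff_iterate_divX, zero_add,
    ← Function.iterate_succ_apply' Polynomial.divX, mul_comm] at h
  exact h.symm

lemma truncEval_eq_zero {μ : Polynomial K} (f : L) {t : ℕ} (ht : μ.natDegree < t) :
    truncEval μ f t = 0 := by
  rw [truncEval, show Polynomial.divX^[t] μ = 0 from ?_, map_zero]
  ext j
  rw [coeff_iterate_divX, Polynomial.coeff_zero]
  exact Polynomial.coeff_eq_zero_of_natDegree_lt (by omega)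

lemma truncEval_natDegree {μ : Polynomial K} (hμ : μ.Monic) (f : L) :
    truncEval μ f μ.natDegree = 1 := by
  rw [truncEval_eq, truncEval_eq_zero f (Nat.lt_succ_self _), mul_zero, zero_add,
    hμ.coeff_natDegree, map_one]

lemma FFPlace.val_mul_truncEval_le (Q : FFPlace k L) {μ : Polynomial K} {f : L}
    (hf : Polynomial.aeval f μ = 0) {x : L} (hx : ∀ i, Q.val (algebraMap K L (μ.coeff i)) ≤ Q.val x)
    (t : ℕ) : Q.val (f * truncEval μ f (t + 1)) ≤ Q.val x := by
  rcases le_or_gt (Q.val f) 1 with hf1 | hf1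
  · have key : ∀ n t, μ.natDegree < t + n → Q.val (truncEval μ f t) ≤ Q.val x := by
      intro n
      induction n with
      | zero => intro t ht; rw [truncEval_eq_zero f (by simpa using ht), map_zero]; exact zero_le
      | succ n ih =>
        intro t ht
        rw [truncEval_eq]
        refine Valuation.map_add_le _ ?_ (hx t)
        rw [map_mul]
        exact mul_le_of_le_one_of_le hf1 (ih (t + 1) (by omega))
    rw [map_mul]
    exact mul_le_of_le_one_of_le hf1 (key (μ.natDegree + 1) _ (by omega))
  · have key : ∀ t, Q.val (truncEval μ f t) ≤ Q.val x →
        Q.val (f * truncEval μ f (t + 1)) ≤ Q.val x := by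
      intro t ht
      rw [eq_sub_of_add_eq (truncEval_eq μ f t).symm]
      exact Valuation.map_sub_le _ ht (hx t)
    refine key t ?_
    induction t with
    | zero => rw [truncEval, Function.iterate_zero_apply, hf, map_zero]; exact zero_le
    | succ t ih =>
      refine le_trans ?_ (key t ih)
      rw [map_mul]
      exact le_mul_of_one_le_left' hf1.le

/-- Generators of `K[f]` over `K` of small height, from a monic equation of `f`. -/
noncomputable def truncGenerator (μ : Polynomial K) (f : L) (t : Fin μ.natDegree) : L :=
  if t.1 = 0 then 1 else f * truncEval μ f (t + 1)

lemma span_range_truncGenerator {μ : Polynomial K} (hμ : μ.Monic) {f : L}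
    (hf : Polynomial.aeval f μ = 0) (hgen : Algebra.adjoin K {f} = ⊤) :
    Submodule.span K (Set.range (truncGenerator μ f)) = ⊤ := by
  set W := Submodule.span K (Set.range (truncGenerator μ f)) with hW
  have hm : 0 < μ.natDegree := by
    rcases Nat.eq_zero_or_pos μ.natDegree with h | h
    · rw [hμ.natDegree_eq_zero.1 h, map_one] at hf
      exact absurd hf one_ne_zero
    · exact h
  have h1 : (1 : L) ∈ W := Submodule.subset_span ⟨⟨0, hm⟩, by simp [truncGenerator]⟩
  have hmap : ∀ x : K, algebraMap K L x ∈ W := fun x => by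
    rw [Algebra.algebraMap_eq_smul_one]; exact W.smul_mem _ h1
  have hfc : ∀ t, f * truncEval μ f (t + 1) ∈ W := by
    intro t
    rcases Nat.eq_zero_or_pos t with rfl | ht
    · rw [eq_sub_of_add_eq (truncEval_eq μ f 0).symm, truncEval, Function.iterate_zero_apply, hf,
        zero_sub]
      exact neg_mem (hmap _)
    · rcases lt_or_ge t μ.natDegree with h | h
      · exact Submodule.subset_span ⟨⟨t, h⟩, by simp [truncGenerator, ht.ne']⟩
      · rw [truncEval_eq_zero f (Nat.lt_succ_of_le h), mul_zero]
        exact zero_mem _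
  have hfW : f ∈ W := by
    have h := hfc (μ.natDegree - 1)
    rwa [Nat.sub_add_cancel hm, truncEval_natDegree hμ, mul_one] at h
  have hmul : ∀ x ∈ W, f * x ∈ W := by
    intro x hx
    induction hx using Submodule.span_induction with
    | mem x hx =>
      obtain ⟨⟨t, ht⟩, rfl⟩ := hx
      rcases Nat.eq_zero_or_pos t with rfl | ht0
      · simpa [truncGenerator] using hfW
      · obtain ⟨t, rfl⟩ := Nat.exists_eq_succ_of_ne_zero ht0.ne'
        rw [truncGenerator, if_neg (by simp), eq_sub_of_add_eq (truncEval_eq μ f (t + 1)).symm,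
          mul_sub, mul_comm f (algebraMap K L _), ← Algebra.smul_def]
        exact sub_mem (hfc t) (W.smul_mem _ hfW)
    | zero => rw [mul_zero]; exact zero_mem _
    | add x y _ _ hx hy => rw [mul_add]; exact add_mem hx hy
    | smul c x _ hx => rw [mul_smul_comm]; exact W.smul_mem _ hx
  rw [eq_top_iff]
  intro x _
  obtain ⟨p, rfl⟩ : ∃ p : Polynomial K, Polynomial.aeval f p = x := by
    rw [← AlgHom.mem_range, ← Algebra.adjoin_singleton_eq_range_aeval, hgen]; trivial
  induction p using Polynomial.induction_on with
  | C a => rw [Polynomial.aeval_C]; exact hmap a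
  | add p q hp hq => rw [map_add]; exact add_mem (hp trivial) (hq trivial)
  | monomial n a h =>
    rw [pow_succ, ← mul_assoc, map_mul, Polynomial.aeval_X, mul_comm]
    exact hmul _ (h trivial)

/-- The Gauss lemma: the maximum of the absolute values of the coefficients is multiplicative. -/
lemma Valuation.mul_coeff_le_of_forall_coeff_mul_le {Γ : Type*} [LinearOrderedCommGroupWithZero Γ]
    (v : Valuation K Γ) {p q : Polynomial K} {i : ℕ} (hi : ∀ j, v (p.coeff j) ≤ v (p.coeff i))
    {c : Γ} (h : ∀ n, v ((p * q).coeff n) ≤ c) (j : ℕ) : v (p.coeff i) * v (q.coeff j) ≤ c := by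
  classical
  rcases eq_or_ne (p.coeff i) 0 with hp0 | hp0
  · rw [hp0, map_zero, zero_mul]; exact zero_le
  rcases eq_or_ne (q.coeff j) 0 with hq0 | hq0
  · rw [hq0, map_zero, mul_zero]; exact zero_le
  obtain ⟨j', hj'mem, hj'⟩ := Finset.exists_max_image (Finset.range (q.natDegree + 1))
      (fun i => v (q.coeff i)) ⟨0, by simp⟩
  have hj' : ∀ n, v (q.coeff n) ≤ v (q.coeff j') := by
    intro n
    by_cases hn : n ∈ Finset.range (q.natDegree + 1)
    · exact hj' n hn
    · rw [Polynomial.coeff_eq_zero_of_natDegree_lt (by simpa [Nat.lt_succ_iff] using hn), map_zero]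
      exact zero_le
  have hexp : ∃ n, v (p.coeff n) = v (p.coeff i) := ⟨i, rfl⟩
  have hexq : ∃ n, v (q.coeff n) = v (q.coeff j') := ⟨j', rfl⟩
  have hpmin := fun n => Nat.find_min hexp (m := n)
  have hqmin := fun n => Nat.find_min hexq (m := n)
  have hpa := Nat.find_spec hexp
  have hqb := Nat.find_spec hexq
  set a := Nat.find hexp
  set b := Nat.find hexq
  have hp1 : 0 < v (p.coeff i) := zero_lt_iff.2 ((Valuation.ne_zero_iff _).2 hp0)
  have hq1 : 0 < v (q.coeff j') :=
    (zero_lt_iff.2 ((Valuation.ne_zero_iff _).2 hq0)).trans_le (hj' j)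
  have key : v ((p * q).coeff (a + b)) = v (p.coeff a * q.coeff b) := by
    have hmem : (a, b) ∈ Finset.HasAntidiagonal.antidiagonal (a + b) :=
      Finset.HasAntidiagonal.mem_antidiagonal.2 rfl
    rw [Polynomial.coeff_mul, ← Finset.add_sum_erase _ _ hmem]
    refine Valuation.map_add_eq_of_lt_left _ (Valuation.map_sum_lt _ ?_ fun x hx => ?_)
    · rw [map_mul, hpa, hqb]
      exact (mul_pos hp1 hq1).ne'
    · obtain ⟨hne, hx⟩ := Finset.mem_erase.1 hx
      rw [Finset.HasAntidiagonal.mem_antidiagonal] at hx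
      rw [map_mul, map_mul, hpa, hqb]
      rcases lt_trichotomy x.1 a with hlt | heq | hlt
      · exact mul_lt_mul_of_lt_of_le_of_nonneg_of_pos
          (lt_of_le_of_ne (hi _) (hpmin _ hlt)) (hj' _) zero_le hq1
      · exact absurd (Prod.ext heq (by simp only; omega)) hne
      · exact mul_lt_mul_of_le_of_lt_of_nonneg_of_pos
          (hi _) (lt_of_le_of_ne (hj' _) (hqmin _ (by omega))) zero_le hp1
  calc v (p.coeff i) * v (q.coeff j) ≤ v (p.coeff i) * v (q.coeff j') := by gcongr; exact hj' j
    _ = v ((p * q).coeff (a + b)) := by rw [key, map_mul, hpa, hqb]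
    _ ≤ c := h _

end MinpolyGenerators

section CastelnuovoSeveri

variable {k K L : Type*} [Field k] [Field K] [Field L] [Algebra k K] [Algebra k L] [Algebra K L]
  [IsScalarTower k K L]

lemma FFPlace.val_algebraMap_le_val_algebraMap_iff [Algebra.IsAlgebraic K L] (Q : FFPlace k L)
    {x y : K} (hy : y ≠ 0) :
    Q.val (algebraMap K L x) ≤ Q.val (algebraMap K L y) ↔
      (Q.restrict K).val x ≤ (Q.restrict K).val y := by
  have h := Q.val_algebraMap_le_one_iff (x / y)
  rwa [map_div₀, map_div₀, map_div₀,
    div_le_one₀ (zero_lt_iff.2 ((Valuation.ne_zero_iff _).2 (by simpa using hy))),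
    div_le_one₀ (zero_lt_iff.2 ((Valuation.ne_zero_iff _).2 hy))] at h

/-- For a sufficiently positive divisor `η` all adeles are congruent to principal ones. -/
lemma exists_adeleSubmodule_le_scaledAdeles_sup {s : Finset (FFPlace k K → K)}
    (hs : adeleSubmodule k K ≤ (integralAdeles k K ⊔ principalAdeles k K) ⊔
      Submodule.span k (s : Set (FFPlace k K → K))) :
    ∃ η : FFPlace k K → K, (∀ P, η P ≠ 0 ∧ P.val (η P) ≤ 1) ∧
      {P : FFPlace k K | P.val (η P) ≠ 1}.Finite ∧
      adeleSubmodule k K ≤ scaledAdeles η ⊔ principalAdeles k K := by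
  classical
  have := (finite_and_finrank_map_mkQ_le hs).1
  obtain ⟨t, htA, -, ht⟩ := exists_finset_le_sup_span (A := adeleSubmodule k K)
    (W := integralAdeles k K ⊔ principalAdeles k K)
  have hex : ∀ P : FFPlace k K, ∃ x : K, x ≠ 0 ∧ P.val x ≤ 1 ∧
      (∀ α ∈ t, P.val (x * α P) ≤ 1) ∧ ((∀ α ∈ t, P.val (α P) ≤ 1) → P.val x = 1) := by
    intro P
    by_cases hP : ∀ α ∈ t, P.val (α P) ≤ 1
    · exact ⟨1, one_ne_zero, by simp, by simpa using hP, by simp⟩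
    · push Not at hP
      obtain ⟨α₀, hα₀, h1⟩ := hP
      obtain ⟨α, hα, hmax⟩ := Finset.exists_max_image t (fun α => P.val (α P)) ⟨α₀, hα₀⟩
      have h2 : 1 < P.val (α P) := h1.trans_le (hmax _ hα₀)
      have h0 : α P ≠ 0 := by rw [← Valuation.ne_zero_iff P.val]; exact (zero_lt_one.trans h2).ne'
      refine ⟨(α P)⁻¹, inv_ne_zero h0, ?_, fun β hβ => ?_, fun h => absurd (h α hα) h2.not_ge⟩
      · rw [map_inv₀]; exact (inv_lt_one_of_one_lt₀ h2).le
      · rw [map_mul, map_inv₀]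
        exact inv_mul_le_one_of_le₀ (hmax β hβ) zero_le
  choose η h0 h1 h2 h3 using hex
  refine ⟨η, fun P => ⟨h0 P, h1 P⟩, ?_, ht.trans ?_⟩
  · refine (Set.Finite.biUnion t.finite_toSet fun α hα => mem_adeleSubmodule.1 (htA α hα)).subset
      fun P hP => ?_
    by_contra h
    refine hP (h3 P fun α hα => ?_)
    by_contra hα'
    exact h (Set.mem_biUnion (Finset.mem_coe.2 hα) ((P.mem_iff _).not.2 hα'))
  · refine sup_le (sup_le_sup_right ?_ _) ((Submodule.span_le.2 ?_).trans le_sup_left)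
    · intro α hα
      rw [mem_scaledAdeles]
      intro P
      rw [map_mul]
      exact mul_le_one' (h1 P) (mem_integralAdeles.1 hα P)
    · intro α hα P
      exact h2 P α hα

lemma Polynomial.eq_zero_of_forall_coeff_eq_zero {ι : Type*} [Fintype ι] {p : ι → Polynomial k}
    (h : ∀ D, (∀ i, (p i).natDegree ≤ D) → ∀ i, (p i).coeff D = 0) (i : ι) : p i = 0 := by
  obtain ⟨j, -, hj⟩ := Finset.exists_max_image Finset.univ (fun i => (p i).natDegree)
    ⟨i, Finset.mem_univ i⟩
  have hj' := h (p j).natDegree fun i => hj i (Finset.mem_univ i)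
  have h0 : p j = 0 := Polynomial.leadingCoeff_eq_zero.1 (hj' j)
  have hi := hj i (Finset.mem_univ i)
  have hi' := hj' i
  rw [h0, Polynomial.natDegree_zero] at hi hi'
  rw [Polynomial.eq_C_of_natDegree_le_zero hi, hi', Polynomial.C_0]

/-- The degree of the polar divisor of the coefficients of the minimal polynomial of `f` over `K`
is at most the degree of `f`. -/
lemma finrank_integralAdeles_map_le (hK : FiniteOverTranscendental k K)
    {s : Finset (FFPlace k K → K)}
    (hs : adeleSubmodule k K ≤ (integralAdeles k K ⊔ principalAdeles k K) ⊔
      Submodule.span k (s : Set (FFPlace k K → K)))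
    {f : L} [FiniteDimensional k⟮f⟯ L] (hf : IsIntegral K f)
    {a : FFPlace k K → K} (ha : ∀ P, ∃ i, a P = (minpoly K f).coeff i)
    (hmax : ∀ (P : FFPlace k K) i, P.val ((minpoly K f).coeff i) ≤ P.val (a P)) :
    Module.Finite k ((integralAdeles k K).map (scaledAdeles a).mkQ) ∧
      Module.finrank k ((integralAdeles k K).map (scaledAdeles a).mkQ) ≤
        Module.finrank k⟮f⟯ L := by
  classical
  have hμ := minpoly.monic hf
  set μ := minpoly K f with hμdef
  have ha1 : ∀ P : FFPlace k K, 1 ≤ P.val (a P) := fun P =>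
    hμ.one_le_val_of_forall_coeff_le (hmax P)
  have ha0 : ∀ P, a P ≠ 0 := fun P => by
    rw [← Valuation.ne_zero_iff P.val]; exact (zero_lt_one.trans_le (ha1 P)).ne'
  have hafin := finite_setOf_val_ne_one_of_dominant_coeff hK hμ ha hmax
  obtain ⟨s₁, hs₁⟩ := exists_integralAdeles_le_scaledAdeles_sup_span hK ha0 hafin
  have hfin := (finite_and_finrank_map_mkQ_le hs₁).1
  refine ⟨hfin, ?_⟩
  obtain ⟨η, hη, hηfin, hηA⟩ := exists_adeleSubmodule_le_scaledAdeles_sup hs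
  let b := Module.finBasis k ((integralAdeles k K).map (scaledAdeles a).mkQ)
  choose v hvA hv using fun i => Submodule.mem_map.1 (b i).2
  have hvind : ∀ c : _ → k, ∑ i, c i • v i ∈ scaledAdeles a → ∀ i, c i = 0 := by
    intro c hc
    refine Fintype.linearIndependent_iff.1 b.linearIndependent c (Subtype.ext ?_)
    rw [← Submodule.Quotient.mk_eq_zero, ← Submodule.mkQ_apply, map_sum] at hc
    rw [Submodule.coe_sum, ZeroMemClass.coe_zero, ← hc]
    exact Finset.sum_congr rfl fun i _ => by rw [Submodule.coe_smul, ← hv i, map_smul]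
  let β := fun i (P : FFPlace k K) => a P / η P * v i P
  have hβ : ∀ i, β i ∈ adeleSubmodule k K := by
    intro i
    rw [mem_adeleSubmodule]
    refine (hafin.union hηfin).subset fun P hP => ?_
    by_contra h
    rw [Set.mem_union, not_or, Set.mem_ofPred_eq, Set.mem_ofPred_eq, not_not, not_not] at h
    refine hP ((P.mem_iff _).2 ?_)
    rw [map_mul, map_div₀, h.1, h.2, div_one, one_mul]
    exact mem_integralAdeles.1 (hvA i) P
  have hdec : ∀ i, ∃ u : K, (β i - fun _ => u) ∈ scaledAdeles η := by
    intro i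
    obtain ⟨γ, hγ, ε, hε, h⟩ := Submodule.mem_sup.1 (hηA (hβ i))
    obtain ⟨u, rfl⟩ := mem_principalAdeles.1 hε
    exact ⟨u, by rwa [← h, add_sub_cancel_right]⟩
  choose u hu using hdec
  have huρ : ∀ i (P : FFPlace k K), P.val (η P / a P * u i) ≤ 1 := by
    intro i P
    have h1 : η P / a P * u i = v i P - (a P)⁻¹ * (η P * (β i - fun _ : FFPlace k K => u i) P) := by
      have := (hη P).1
      have := ha0 P
      simp only [β, Pi.sub_apply]
      field_simp
      ring
    rw [h1]
    refine Valuation.map_sub_le _ (mem_integralAdeles.1 (hvA i) P) ?_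
    rw [map_mul, map_inv₀]
    exact mul_le_one' (inv_le_one_of_one_le₀ (ha1 P)) (hu i P)
  have huind : ∀ c : _ → k, (∀ P : FFPlace k K, P.val (η P * ∑ i, c i • u i) ≤ 1) →
      ∀ i, c i = 0 := by
    intro c hc
    refine hvind c fun P => ?_
    have h1 : a P * (∑ i, c i • v i) P = η P * (∑ i, c i • u i) +
        η P * (∑ i, c i • (β i - fun _ : FFPlace k K => u i)) P := by
      rw [← mul_add, Finset.sum_apply, Finset.sum_apply, ← Finset.sum_add_distrib, Finset.mul_sum,
        Finset.mul_sum]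
      refine Finset.sum_congr rfl fun i _ => ?_
      have := (hη P).1
      simp only [β, Pi.sub_apply, Pi.smul_apply]
      rw [← smul_add, mul_smul_comm, mul_smul_comm]
      congr 1
      field_simp
      ring
    rw [h1]
    exact Valuation.map_add_le _ (hc P)
      ((sum_mem fun i _ => Submodule.smul_mem _ _ (hu i) :
        ∑ i, c i • (β i - fun _ => u i) ∈ scaledAdeles η) P)
  have hli : LinearIndependent k⟮f⟯ (fun i => algebraMap K L (u i)) := by
    refine linearIndependent_adjoin_simple_of_aeval fun p hp =>
      Polynomial.eq_zero_of_forall_coeff_eq_zero fun D hD => ?_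
    set G : Polynomial K := ∑ i, (p i).map (algebraMap k K) * Polynomial.C (u i) with hG
    have hGcoeff : ∀ n, G.coeff n = ∑ i, (p i).coeff n • u i := by
      intro n
      rw [hG, Polynomial.finsetSum_coeff]
      exact Finset.sum_congr rfl fun i _ => by
        rw [Polynomial.coeff_mul_C, Polynomial.coeff_map, Algebra.smul_def]
    obtain ⟨h, hGh⟩ : μ ∣ G := by
      refine minpoly.dvd K f ?_
      rw [← hp, hG, map_sum]
      exact Finset.sum_congr rfl fun i _ => by
        rw [map_mul, Polynomial.aeval_C, Polynomial.aeval_map_algebraMap]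
    have hh : ∀ (P : FFPlace k K) j, P.val (η P * h.coeff j) ≤ 1 := by
      intro P j
      obtain ⟨i, hi⟩ := ha P
      have h1 := Valuation.mul_coeff_le_of_forall_coeff_mul_le P.val (p := μ) (q := h) (i := i)
        (hi ▸ hmax P) (c := P.val (a P / η P)) (fun n => ?_) j
      · rw [← hi, map_div₀] at h1
        have hη0 := zero_lt_iff.2 ((Valuation.ne_zero_iff P.val).2 (hη P).1)
        rw [le_div_iff₀ hη0, mul_assoc] at h1
        have h2 := le_of_mul_le_mul_left (h1.trans_eq (mul_one _).symm)
          (zero_lt_one.trans_le (ha1 P))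
        rwa [map_mul, mul_comm]
      · rw [← hGh, hGcoeff]
        refine Valuation.map_sum_le _ fun i _ => ?_
        have h3 : (p i).coeff n • u i =
            algebraMap k K ((p i).coeff n) * (a P / η P) * (η P / a P * u i) := by
          have := (hη P).1
          have := ha0 P
          rw [Algebra.smul_def]
          field_simp
        rw [h3, map_mul, map_mul]
        exact mul_le_of_le_of_le_one
          (mul_le_of_le_one_of_le (P.val_algebraMap_le_one _) le_rfl) (huρ i P)
    refine huind _ fun P => ?_
    rw [← hGcoeff]
    rcases eq_or_ne (G.coeff D) 0 with h0 | h0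
    · rw [h0]; simp
    have hGD : G.natDegree = D := by
      refine le_antisymm (Polynomial.natDegree_sum_le_of_forall_le _ _ fun i _ => ?_)
        (Polynomial.le_natDegree_of_ne_zero h0)
      refine (Polynomial.natDegree_mul_C_le _ _).trans ?_
      exact (Polynomial.natDegree_map_le).trans (hD i)
    rw [← hGD, Polynomial.coeff_natDegree, hGh, Polynomial.leadingCoeff_mul,
      hμ.leadingCoeff, one_mul]
    exact hh P _
  have h := hli.fintype_card_le_finrank
  rwa [Fintype.card_fin] at h

/-- If `f` is transcendental over `k` and not in `K`, some coefficient of its minimal polynomial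
over `K` has a pole. -/
lemma exists_one_lt_val_of_dominant_coeff [Algebra.IsAlgebraic K L] {f : L}
    (hf : Transcendental k f) {a : FFPlace k K → K}
    (hmax : ∀ (P : FFPlace k K) i, P.val ((minpoly K f).coeff i) ≤ P.val (a P)) :
    ∃ P : FFPlace k K, 1 < P.val (a P) := by
  obtain ⟨Q, hQ⟩ := FFPlace.exists_notMem_of_transcendental hf
  have hint : IsIntegral K f := Algebra.IsIntegral.isIntegral f
  refine ⟨Q.restrict K, ?_⟩
  by_contra! h
  rw [Q.mem_iff] at hQ
  refine hQ ?_
  have h1 := Q.val_mul_truncEval_le (minpoly.aeval K f) (x := 1)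
    (fun i => by
      rw [map_one, Q.val_algebraMap_le_one_iff]
      exact (hmax _ i).trans h) ((minpoly K f).natDegree - 1)
  rwa [Nat.sub_add_cancel (minpoly.natDegree_pos hint),
    truncEval_natDegree (minpoly.monic hint), mul_one, map_one] at h1

/-- The Castelnuovo–Severi inequality for the compositum of a function field `K` and a rational
function field `k(f)`. -/
theorem genus_le_of_adjoin_simple_eq_top [FiniteDimensional K L]
    (hL : FiniteOverTranscendental k L) {x : K} (hx : Transcendental k x)
    {f : L} (hf : Transcendental k f) (hgen : K⟮f⟯ = ⊤) :
    genus k L ≤ Module.finrank K L * genus k K +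
      (Module.finrank K L - 1) * (Module.finrank k⟮f⟯ L - 1) := by
  classical
  have := hL f hf
  have hK : FiniteOverTranscendental k K := .of_tower hL
  have hint : IsIntegral K f := Algebra.IsIntegral.isIntegral f
  have hμ := minpoly.monic hint
  have hm : (minpoly K f).natDegree = Module.finrank K L := by
    rw [← IntermediateField.adjoin.finrank hint, hgen, IntermediateField.finrank_top']
  have hadj : Algebra.adjoin K {f} = ⊤ := by
    rw [← IntermediateField.adjoin_simple_toSubalgebra_of_isAlgebraic hint.isAlgebraic, hgen,
      IntermediateField.top_toSubalgebra]
  obtain ⟨a, ha, hmax⟩ := exists_dominant_coeff (k := k) (minpoly K f)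
  have ha1 : ∀ P : FFPlace k K, 1 ≤ P.val (a P) := fun P =>
    hμ.one_le_val_of_forall_coeff_le (hmax P)
  obtain ⟨t, ht⟩ := exists_adeleSubmodule_le_sup_span hK hx
  obtain ⟨hfin, hrank⟩ := finrank_integralAdeles_map_le hK ht hint ha hmax
  have := (finite_and_finrank_map_mkQ_le ht).1
  obtain ⟨s₀, -, hs₀, hs₀A⟩ := exists_finset_le_sup_span (A := adeleSubmodule k K)
    (W := integralAdeles k K ⊔ principalAdeles k K)
  rw [← genus_eq_finrank_map] at hs₀
  obtain ⟨P, hP⟩ := exists_one_lt_val_of_dominant_coeff hf hmax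
  obtain ⟨hfin', hrank'⟩ := finrank_map_mkQ_sup_add_one_le (A := integralAdeles k K)
    (W := scaledAdeles a) (W' := scaledAdeles a ⊔ principalAdeles k K) le_sup_left
    (v := fun _ => 1) (mem_integralAdeles.2 fun P => by simp)
    (fun h => by simpa using (h P).trans_lt hP)
      (Submodule.mem_sup_right (const_mem_principalAdeles _))
  obtain ⟨s₁, -, hs₁, hs₁A⟩ := exists_finset_le_sup_span (A := integralAdeles k K)
    (W := scaledAdeles a ⊔ principalAdeles k K)
  obtain ⟨r, hr, hrA⟩ := exists_adeleSubmodule_le_sup_span_of_tower hL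
    (span_range_truncGenerator hμ (minpoly.aeval K f) hadj)
    (δ := fun t P => if t.1 = 0 then 1 else a P)
    (fun t Q => by
      rw [truncGenerator]
      split_ifs with h
      · simp
      · refine Q.val_mul_truncEval_le (minpoly.aeval K f) (fun i => ?_) t
        have ha0 : a (Q.restrict K) ≠ 0 := by
          rw [← Valuation.ne_zero_iff (Q.restrict K).val]
          exact (zero_lt_one.trans_le (ha1 _)).ne'
        exact (Q.val_algebraMap_le_val_algebraMap_iff ha0).2 (hmax _ i))
    (fun t => if t.1 = 0 then s₀ else s₀ ∪ s₁)
    (fun t => by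
      split_ifs with h
      · refine hs₀A.trans (le_of_eq ?_)
        rw [integralAdeles_eq_scaledAdeles_one]; rfl
      · refine hs₀A.trans ?_
        rw [Finset.coe_union, Submodule.span_union]
        refine sup_le (sup_le (hs₁A.trans ?_) (le_sup_right.trans le_sup_left)) ?_
        · exact sup_le_sup_left le_sup_right _
        · exact le_sup_left.trans le_sup_right)
  refine (genus_le_card hrA).trans (hr.trans ?_)
  obtain ⟨m, hm'⟩ := Nat.exists_eq_succ_of_ne_zero (minpoly.natDegree_pos hint).ne'
  calc ∑ t : Fin (minpoly K f).natDegree, (if t.1 = 0 then s₀ else s₀ ∪ s₁).card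
      ≤ ∑ t : Fin (minpoly K f).natDegree,
          (genus k K + if t.1 = 0 then 0 else Module.finrank k⟮f⟯ L - 1) := by
        refine Finset.sum_le_sum fun t _ => ?_
        split_ifs with h
        · exact hs₀
        · exact (Finset.card_union_le _ _).trans (by omega)
    _ = _ := by
        rw [Finset.sum_add_distrib, Finset.sum_const, Finset.card_univ, Fintype.card_fin,
          smul_eq_mul, Fin.sum_univ_eq_sum_range (fun t => if t = 0 then 0 else
            Module.finrank k⟮f⟯ L - 1), ← hm, hm', Finset.sum_range_succ']
        simp

end CastelnuovoSeveri

section Degrees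

variable {k F : Type*} [Field k] [Field F] [Algebra k F]

lemma IsFunctionField.finiteOverTranscendental (hF : IsFunctionField k F) :
    FiniteOverTranscendental k F := by
  obtain ⟨x, hx, hfin⟩ := hF
  intro y hy
  have halg : Algebra.IsAlgebraic (Algebra.adjoin k {x}) F := by
    open scoped IntermediateField.algebraAdjoinAdjoin in
    exact ⟨fun z => (IsFractionRing.isAlgebraic_iff (Algebra.adjoin k {x}) k⟮x⟯ F).2
      (Algebra.IsAlgebraic.isAlgebraic z)⟩
  have hbasis : IsTranscendenceBasis k (fun _ : Unit => y) := by
    refine ((algebraicIndependent_singleton_iff ()).2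
      hy).isTranscendenceBasis_of_lift_trdeg_le_of_finite ?_
    simpa using Algebra.IsAlgebraic.trdeg_le_cardinalMk k ({x} : Set F)
  have halgy := hbasis.isAlgebraic_field
  rw [Set.range_const] at halgy
  have : Algebra.EssFiniteType k k⟮x⟯ :=
    IntermediateField.essFiniteType_iff.2
      (IntermediateField.fg_adjoin_of_finite (Set.finite_singleton x))
  have : Algebra.EssFiniteType k F := .comp k k⟮x⟯ F
  have : Algebra.EssFiniteType k⟮y⟯ F := .of_comp k _ _
  exact Algebra.finite_of_essFiniteType_of_isAlgebraic

variable {K L : Type*} [Field K] [Field L] [Algebra k K] [Algebra k L] [Algebra K L]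
  [IsScalarTower k K L]

lemma finrank_adjoin_simple_mul_finrank (y : K) :
    Module.finrank k⟮y⟯ K * Module.finrank K L =
      Module.finrank k⟮algebraMap K L y⟯ L := by
  let e : k⟮y⟯ ≃ₐ[k] k⟮algebraMap K L y⟯ :=
    (k⟮y⟯.equivMap (IsScalarTower.toAlgHom k K L)).trans
      (IntermediateField.equivOfEq (by rw [adjoin_map, Set.image_singleton]; rfl))
  rw [Module.finrank_mul_finrank]
  refine Algebra.finrank_eq_of_equiv_equiv e.toRingEquiv (RingEquiv.refl L) ?_
  ext z
  rfl

lemma exists_transcendental_of_finiteDimensional [FiniteDimensional K L] {x : L}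
    (hx : Transcendental k x) : ∃ y : K, Transcendental k y := by
  by_contra! h
  have : Algebra.IsAlgebraic k K := ⟨fun y => not_not.1 (h y)⟩
  exact hx ((Algebra.IsAlgebraic.isAlgebraic (R := K) x).restrictScalars k)

lemma genus_le_sq_of_adjoin_simple_eq_top {F : Type*} [Field F] [Algebra k F] [Algebra K F]
    [Algebra L F] [IsScalarTower k L F] [IsScalarTower K L F] [FiniteDimensional K L]
    [FiniteDimensional L F] (hF : FiniteOverTranscendental k F) {x : K} (hx : Transcendental k x)
    {f : L} (hf : Transcendental k f) (hgen : K⟮f⟯ = ⊤) {e : ℕ} (he : 0 < e)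
    (hdeg : Module.finrank k⟮algebraMap L F f⟯ F = e * Module.finrank K F)
    (hgenus : genus k K ≤ (e - 1) ^ 2) :
    genus k L ≤ (e * Module.finrank K L - 1) ^ 2 := by
  have hcs := genus_le_of_adjoin_simple_eq_top (.of_tower hF) hx hf hgen
  rw [← finrank_adjoin_simple_mul_finrank, ← Module.finrank_mul_finrank K L F, ← mul_assoc] at hdeg
  rw [Nat.eq_of_mul_eq_mul_right Module.finrank_pos hdeg] at hcs
  have hm : 0 < Module.finrank K L := Module.finrank_pos
  obtain ⟨e, rfl⟩ := Nat.exists_eq_add_of_lt he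
  obtain ⟨m, hm⟩ := Nat.exists_eq_add_of_lt hm
  rw [zero_add] at *
  rw [hm] at hcs ⊢
  have h1 : (e + 1) * (m + 1) - 1 = e * m + e + m := by
    rw [Nat.sub_eq_of_eq_add]; ring
  rw [Nat.add_sub_cancel] at hgenus
  rw [h1, Nat.add_sub_cancel] at hcs
  rw [h1]
  calc genus k L ≤ (m + 1) * e ^ 2 + m * (e * m + e + m) := hcs.trans (by gcongr)
    _ ≤ (e * m + e + m) ^ 2 := by
      nlinarith [Nat.zero_le (e * m), Nat.zero_le (e ^ 2 * m), Nat.zero_le (e ^ 2 * m ^ 2),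
        Nat.zero_le (e * m ^ 2)]

end Degrees

/-- key lemma for the tower theorem: let `X` be a geometrically integral curve
over a perfect field `k`, with function field `k(X) = F`, and let `d` be a positive integer.
If `E` is a `d`-controlled subfield of `F` and `f ∈ F` has degree `d` (i.e. `[F : k(f)] = d`),
then the compositum `E(f) = E ⊔ k(f)` is `d`-controlled. -/
theorem isDControlled_sup_adjoin
    (k F : Type*) [Field k] [Field F] [Algebra k F] [PerfectField k]
    (hF : IsFunctionField k F)
    [IsDomain (TensorProduct k (AlgebraicClosure k) F)]
    (d : ℕ) (hd : 0 < d)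
    (E : IntermediateField k F) (hE : IsDControlled k F d E)
    (f : F) (hf : Transcendental k f)
    (hdeg : Module.finrank (IntermediateField.adjoin k {f}) F = d) :
    IsDControlled k F d (E ⊔ IntermediateField.adjoin k {f}) := by
  have hfun := hF.finiteOverTranscendental
  obtain ⟨e, he, hed, hgenus⟩ := hE
  have hEF : FiniteDimensional E F :=
    FiniteDimensional.of_finrank_pos (Nat.pos_of_ne_zero
      fun h => hd.ne' (by rw [← hed, h, mul_zero]))
  obtain ⟨x, hx⟩ := exists_transcendental_of_finiteDimensional (K := E) hf
  let E' := E ⊔ k⟮f⟯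
  let _ : Algebra E E' := (IntermediateField.inclusion (le_sup_left : E ≤ E')).toAlgebra
  have : IsScalarTower k E E' := .of_algebraMap_eq fun _ => rfl
  have : IsScalarTower E E' F := .of_algebraMap_eq fun _ => rfl
  have : FiniteDimensional E E' := .left E E' F
  have : FiniteDimensional E' F := .right E E' F
  have : Module.Free E E' := .of_divisionRing E E'
  have : Module.Free E' F := .of_divisionRing E' F
  let f' : E' := ⟨f, (le_sup_right : k⟮f⟯ ≤ E') (mem_adjoin_simple_self k f)⟩
  have hf' : Transcendental k f' := by
    rw [← transcendental_algebraMap_iff (algebraMap E' F).injective]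
    exact hf
  have hgen : E⟮f'⟯ = ⊤ := by
    have hle : E' ≤ IntermediateField.lift (E⟮f'⟯.restrictScalars k) := by
      refine sup_le (fun y hy => ?_) (IntermediateField.adjoin_simple_le_iff.2 ?_)
      · exact ⟨_, E⟮f'⟯.algebraMap_mem ⟨y, hy⟩, rfl⟩
      · exact ⟨f', mem_adjoin_simple_self E f', rfl⟩
    refine eq_top_iff.2 fun z _ => ?_
    obtain ⟨z', hz', h⟩ := hle z.2
    rwa [Subtype.ext h] at hz'
  refine ⟨e * Module.finrank E E', Nat.mul_pos he Module.finrank_pos, ?_,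
    genus_le_sq_of_adjoin_simple_eq_top hfun hx hf' hgen he (hdeg.trans hed.symm) hgenus⟩
  exact (mul_assoc _ _ _).trans
    ((congrArg (e * ·) (Module.finrank_mul_finrank E E' F)).trans hed)
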